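/- arXiv:math/9812123 — 3 statements merged into one kernel-verified Lean document; each statement's English description precedes it below -/
import Mathlib

section
/- For each fixed integer k ≥ 1, f(0,k,n) ∼ (2^k/√k) · (π log n)^{(k−1)/2} as n → ∞; that is, the ratio f(0,k,n) / ((2^k/√k)(π log n)^{(k−1)/2}) tends to 1 as n → ∞. -/
open MeasureTheory Filter Real

noncomputable section

/-- The orthogonal group O(n) of ℝⁿ. -/
abbrev OG (n : ℕ) : Type := Matrix.orthogonalGroup (Fin n) ℝ

instance (n : ℕ) : MeasurableSpace (OG n) := borel _
instance (n : ℕ) : BorelSpace (OG n) := ⟨rfl⟩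

/-- The natural action of `g ∈ O(n)` on `ℝⁿ`. -/
def act {n : ℕ} (g : OG n) (x : EuclideanSpace ℝ (Fin n)) : EuclideanSpace ℝ (Fin n) :=
  Matrix.toEuclideanLin (g : Matrix (Fin n) (Fin n) ℝ) x

/-- `E_k`: the span of the first `k` standard basis vectors of `ℝⁿ`, as a set. -/
def Ek (n k : ℕ) : Set (EuclideanSpace ℝ (Fin n)) :=
  {x | ∀ i : Fin n, k ≤ (i : ℕ) → x i = 0}

/-- The `m`-dimensional face `{x : |xᵢ| ≤ 1 for i < m, xᵢ = 1 for i ≥ m}` of the cube `[-1,1]ⁿ`. -/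
def cubeFace (n m : ℕ) : Set (EuclideanSpace ℝ (Fin n)) :=
  {x | (∀ i : Fin n, (i : ℕ) < m → |x i| ≤ 1) ∧ ∀ i : Fin n, m ≤ (i : ℕ) → x i = 1}

/-- `f(j,k,n)`, the expected number of `j`-faces of a random `k`-section of the `n`-cube,
computed with respect to the probability measure `H` on `O(n)`. -/
def expFaces (n : ℕ) (H : Measure (OG n)) (j k : ℕ) : ℝ :=
  2 ^ (k - j) * (n.choose (k - j)) *
    (H {g | (act g '' Ek n k ∩ cubeFace n (n - k + j)).Nonempty}).toReal


open ProbabilityTheory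

/-- i.i.d. standard Gaussian rows -/
def gRows (k : ℕ) (ι : Type) [Fintype ι] : Measure (ι → EuclideanSpace ℝ (Fin k)) :=
  Measure.pi (fun _ : ι => stdGaussian (EuclideanSpace ℝ (Fin k)))

instance (k : ℕ) (ι : Type) [Fintype ι] : IsProbabilityMeasure (gRows k ι) := by
  unfold gRows; infer_instance

lemma map_inner_stdGaussian {k : ℕ} (u : EuclideanSpace ℝ (Fin k)) (hu : ‖u‖ = 1) :
    (stdGaussian (EuclideanSpace ℝ (Fin k))).map (fun x => inner ℝ x u) = gaussianReal 0 1 := by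
  have h := IsGaussian.map_eq_gaussianReal (μ := stdGaussian (EuclideanSpace ℝ (Fin k)))
    (innerSL ℝ u)
  rw [integral_strongDual_stdGaussian, variance_dual_stdGaussian, innerSL_apply_norm, hu] at h
  simp only [one_pow, Real.toNNReal_one] at h
  rw [← h]
  congr 1
  ext x
  simp [real_inner_comm]

lemma stdGaussian_piLp (k : ℕ) (ι : Type) [Fintype ι] :
    (gRows k ι).map (WithLp.toLp 2) =
      stdGaussian (PiLp 2 (fun _ : ι => EuclideanSpace ℝ (Fin k))) := by
  apply Measure.ext_of_charFun (E := PiLp 2 (fun _ : ι => EuclideanSpace ℝ (Fin k)))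
  ext t
  simp_rw [gRows, charFun_stdGaussian, charFun_pi, charFun_stdGaussian, ← Complex.exp_sum,
    ← Complex.ofReal_pow, PiLp.norm_sq_eq_of_L2]
  simp [Finset.sum_div, neg_div]

/-- action of a square matrix on a family of vectors -/
def rowAct {k : ℕ} {ι : Type} [Fintype ι] (M : Matrix ι ι ℝ)
    (A : ι → EuclideanSpace ℝ (Fin k)) : ι → EuclideanSpace ℝ (Fin k) :=
  fun i => ∑ j, M i j • A j

lemma rowAct_mul {k : ℕ} {ι : Type} [Fintype ι] (M N : Matrix ι ι ℝ)
    (A : ι → EuclideanSpace ℝ (Fin k)) : rowAct (M * N) A = rowAct M (rowAct N A) := by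
  ext1 i
  simp only [rowAct, Matrix.mul_apply, Finset.sum_smul, Finset.smul_sum, smul_smul]
  rw [Finset.sum_comm]

lemma rowAct_one {k : ℕ} {ι : Type} [Fintype ι] [DecidableEq ι]
    (A : ι → EuclideanSpace ℝ (Fin k)) : rowAct (1 : Matrix ι ι ℝ) A = A := by
  ext1 i
  simp [rowAct, Matrix.one_apply]

lemma rowAct_inner {k : ℕ} {ι : Type} [Fintype ι] [DecidableEq ι] (M : Matrix ι ι ℝ)
    (hM : M.transpose * M = 1) (A : ι → EuclideanSpace ℝ (Fin k)) :
    ∑ i, inner ℝ (rowAct M A i) (rowAct M A i) = ∑ i, inner ℝ (A i) (A i) := by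
  have h1 : ∀ i, inner ℝ (rowAct M A i) (rowAct M A i)
      = ∑ j, ∑ l, (M i j * M i l) * inner ℝ (A j) (A l) := by
    intro i
    simp only [rowAct, sum_inner, inner_sum, real_inner_smul_left, real_inner_smul_right]
    refine Finset.sum_congr rfl fun j _ => Finset.sum_congr rfl fun l _ => by
      rw [real_inner_comm]; ring
  simp_rw [h1]
  rw [Finset.sum_comm]
  refine Finset.sum_congr rfl fun j _ => ?_
  rw [Finset.sum_comm]
  have h2 : ∀ l, ∑ i, M i j * M i l * inner ℝ (A j) (A l)
      = (1 : Matrix ι ι ℝ) j l * inner ℝ (A j) (A l) := by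
    intro l
    rw [← hM, Matrix.mul_apply, Finset.sum_mul]
    rfl
  simp_rw [h2, Matrix.one_apply]
  simp

lemma measurable_rowAct {k : ℕ} {ι : Type} [Fintype ι] (M : Matrix ι ι ℝ) :
    Measurable (rowAct (k := k) M) := by
  unfold rowAct; fun_prop

lemma map_rowAct {k : ℕ} {ι : Type} [Fintype ι] [DecidableEq ι] (M : Matrix ι ι ℝ)
    (hM : M.transpose * M = 1) :
    (gRows k ι).map (rowAct M) = gRows k ι := by
  have hM' : M * M.transpose = 1 := mul_eq_one_comm.mp hM
  let L : PiLp 2 (fun _ : ι => EuclideanSpace ℝ (Fin k)) ≃ₗ[ℝ]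
      PiLp 2 (fun _ : ι => EuclideanSpace ℝ (Fin k)) :=
    { toFun := fun A => WithLp.toLp 2 (rowAct M (WithLp.ofLp A))
      map_add' := by
        intro A B
        ext i : 1
        simp [rowAct, Finset.sum_add_distrib]
      map_smul' := by
        intro c A
        ext i : 1
        simp [rowAct, Finset.smul_sum, smul_comm c]
      invFun := fun A => WithLp.toLp 2 (rowAct M.transpose (WithLp.ofLp A))
      left_inv := by
        intro A
        simp [← rowAct_mul, hM, rowAct_one]
      right_inv := by
        intro A
        simp [← rowAct_mul, hM', rowAct_one] }
  let F : PiLp 2 (fun _ : ι => EuclideanSpace ℝ (Fin k)) ≃ₗᵢ[ℝ]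
      PiLp 2 (fun _ : ι => EuclideanSpace ℝ (Fin k)) :=
    { L with
      norm_map' := by
        intro A
        have h := rowAct_inner M hM (WithLp.ofLp A)
        have : ‖L A‖ ^ 2 = ‖A‖ ^ 2 := by
          rw [PiLp.norm_sq_eq_of_L2, PiLp.norm_sq_eq_of_L2]
          simp only [real_inner_self_eq_norm_sq] at h
          exact h
        exact (sq_eq_sq₀ (norm_nonneg _) (norm_nonneg _)).mp this }
  have hF := stdGaussian_map F
  rw [← stdGaussian_piLp] at hF
  have h2 : rowAct M = (fun A : PiLp 2 (fun _ : ι => EuclideanSpace ℝ (Fin k)) => WithLp.ofLp A) ∘ F ∘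
    (WithLp.toLp 2 : (ι → EuclideanSpace ℝ (Fin k)) → _) := rfl
  have hm1 : Measurable (WithLp.toLp 2 : (ι → EuclideanSpace ℝ (Fin k)) →
    PiLp 2 (fun _ : ι => EuclideanSpace ℝ (Fin k))) := by fun_prop
  have hm2 : Measurable (fun A : PiLp 2 (fun _ : ι => EuclideanSpace ℝ (Fin k)) => WithLp.ofLp A) := by
    fun_prop
  rw [h2, ← Measure.map_map hm2 (F.continuous.measurable.comp hm1),
    ← Measure.map_map F.continuous.measurable hm1, hF, Measure.map_map hm2 hm1]
  exact Measure.map_id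

lemma stdGaussian_submodule {k : ℕ} (S : Submodule ℝ (EuclideanSpace ℝ (Fin k))) (hS : S ≠ ⊤) :
    stdGaussian (EuclideanSpace ℝ (Fin k)) (S : Set (EuclideanSpace ℝ (Fin k))) = 0 := by
  have h1 : Sᗮ ≠ ⊥ := by
    intro h
    exact hS (Submodule.orthogonal_eq_bot_iff.mp h)
  obtain ⟨v, hv, hv0⟩ := Submodule.exists_mem_ne_zero_of_ne_bot h1
  have hu : ‖(‖v‖⁻¹ • v)‖ = 1 := by
    rw [norm_smul, norm_inv, norm_norm, inv_mul_cancel₀ (norm_ne_zero_iff.mpr hv0)]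
  have h := map_inner_stdGaussian _ hu
  have hmeas : Measurable (fun x : EuclideanSpace ℝ (Fin k) => inner ℝ x (‖v‖⁻¹ • v)) := by fun_prop
  have h0 : (gaussianReal 0 1) {(0:ℝ)} = 0 := by
    have := nullSingletonClass_gaussianReal (μ := 0) (v := 1) one_ne_zero
    exact measure_singleton _
  rw [← h, Measure.map_apply hmeas (measurableSet_singleton _)] at h0
  refine measure_mono_null ?_ h0
  intro x hx
  have : inner ℝ x v = 0 := (Submodule.mem_orthogonal S v).mp hv x hx
  simp [real_inner_smul_right, this]

lemma ae_linearIndependent_fin (k : ℕ) : ∀ r, r ≤ k →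
    ∀ᵐ A ∂(gRows k (Fin r)), LinearIndependent ℝ A := by
  intro r
  induction r with
  | zero => intro _; exact Filter.Eventually.of_forall fun A => linearIndependent_empty_type
  | succ r ih =>
    intro hr
    have ih := ih (by omega)
    have hmp := (measurePreserving_piFinSuccAbove
      (fun _ : Fin (r+1) => stdGaussian (EuclideanSpace ℝ (Fin k))) 0)
    have key : ∀ᵐ p ∂((stdGaussian (EuclideanSpace ℝ (Fin k))).prod (gRows k (Fin r))),
        LinearIndependent ℝ (Fin.cons p.1 p.2 : Fin (r+1) → EuclideanSpace ℝ (Fin k)) := by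
      have hcont : Continuous (fun p : EuclideanSpace ℝ (Fin k) × (Fin r → EuclideanSpace ℝ (Fin k))
          => (Fin.cons p.1 p.2 : Fin (r+1) → EuclideanSpace ℝ (Fin k))) := by
        fun_prop
      have hms := (isOpen_setOfPred_linearIndependent (𝕜 := ℝ) (E := EuclideanSpace ℝ (Fin k))
        (ι := Fin (r+1))).preimage hcont
      have hms' : MeasurableSet {p : EuclideanSpace ℝ (Fin k) × (Fin r → EuclideanSpace ℝ (Fin k)) |
          LinearIndependent ℝ (Fin.cons p.1 p.2 : Fin (r+1) → EuclideanSpace ℝ (Fin k))} :=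
        hms.measurableSet
      rw [Measure.ae_prod_iff_ae_ae hms', Measure.ae_ae_comm hms']
      filter_upwards [ih] with C hC
      have hS : Submodule.span ℝ (Set.range C) ≠ ⊤ := by
        intro h
        have h1 := finrank_span_eq_card hC
        rw [h, finrank_top] at h1
        simp at h1
        omega
      have h0 := stdGaussian_submodule _ hS
      have h0' : ∀ᵐ x ∂(stdGaussian (EuclideanSpace ℝ (Fin k))),
          x ∉ Submodule.span ℝ (Set.range C) := by
        rw [ae_iff]; simpa using h0
      filter_upwards [h0'] with x hx
      exact linearIndependent_finCons.mpr ⟨hC, hx⟩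
    have := hmp.quasiMeasurePreserving.ae key
    unfold gRows
    filter_upwards [this] with A hA
    convert hA using 1
    ext i : 1
    refine Fin.cases ?_ (fun j => ?_) i
    · rfl
    · rfl

lemma ae_linearIndependent (k : ℕ) (ι : Type) [Fintype ι] (h : Fintype.card ι ≤ k) :
    ∀ᵐ A ∂(gRows k ι), LinearIndependent ℝ A := by
  have e := Fintype.equivFin ι
  have hmp := measurePreserving_piCongrLeft
    (fun _ : Fin (Fintype.card ι) => stdGaussian (EuclideanSpace ℝ (Fin k))) e
  have := hmp.quasiMeasurePreserving.ae (ae_linearIndependent_fin k _ h)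
  unfold gRows
  filter_upwards [this] with A hA
  have h2 : A = (MeasurableEquiv.piCongrLeft (fun _ : Fin (Fintype.card ι) =>
    EuclideanSpace ℝ (Fin k)) e A) ∘ e := by
    ext1 i
    simp [MeasurableEquiv.piCongrLeft]
  rw [h2]
  exact hA.comp _ e.injective

lemma ae_linearIndependent_sub (k : ℕ) (ι : Type) [Fintype ι] (p : ι → Prop) [DecidablePred p]
    (h : Fintype.card {i // p i} ≤ k) :
    ∀ᵐ A ∂(gRows k ι), LinearIndependent ℝ (fun i : {i // p i} => A i) := by
  have hmp := measurePreserving_piEquivPiSubtypeProd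
    (fun _ : ι => stdGaussian (EuclideanSpace ℝ (Fin k))) p
  have h1 : ∀ᵐ x ∂((gRows k {i // p i}).prod (gRows k {i // ¬ p i})), LinearIndependent ℝ x.1 :=
    Measure.quasiMeasurePreserving_fst.ae (ae_linearIndependent k _ h)
  exact hmp.quasiMeasurePreserving.ae h1

lemma measurableSet_exists_closed {X : Type*} [TopologicalSpace X] [MeasurableSpace X]
    [OpensMeasurableSpace X] {k : ℕ} (K : Set (X × EuclideanSpace ℝ (Fin k))) (hK : IsClosed K) :
    MeasurableSet {x : X | ∃ y, (x, y) ∈ K} := by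
  have h : {x : X | ∃ y, (x, y) ∈ K} =
      ⋃ N : ℕ, {x : X | ∃ y ∈ Metric.closedBall (0 : EuclideanSpace ℝ (Fin k)) N, (x, y) ∈ K} := by
    ext x
    simp only [Set.mem_ofPred_eq, Set.mem_iUnion]
    constructor
    · rintro ⟨y, hy⟩
      obtain ⟨N, hN⟩ := exists_nat_ge ‖y‖
      exact ⟨N, y, by simpa using hN, hy⟩
    · rintro ⟨N, y, -, hy⟩
      exact ⟨y, hy⟩
  rw [h]
  refine MeasurableSet.iUnion fun N => IsClosed.measurableSet ?_
  have hc := isCompact_closedBall (0 : EuclideanSpace ℝ (Fin k)) (N : ℝ)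
  have : CompactSpace (Metric.closedBall (0 : EuclideanSpace ℝ (Fin k)) (N : ℝ)) :=
    isCompact_iff_compactSpace.mp hc
  have h2 : {x : X | ∃ y ∈ Metric.closedBall (0 : EuclideanSpace ℝ (Fin k)) N, (x, y) ∈ K} =
      Prod.fst '' ((fun q : X × Metric.closedBall (0 : EuclideanSpace ℝ (Fin k)) (N : ℝ) =>
        (q.1, (q.2 : EuclideanSpace ℝ (Fin k)))) ⁻¹' K) := by
    ext x
    constructor
    · rintro ⟨y, hy, hyK⟩
      exact ⟨(x, ⟨y, hy⟩), hyK, rfl⟩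
    · rintro ⟨⟨x', y⟩, hyK, rfl⟩
      exact ⟨y, y.2, hyK⟩
  rw [h2]
  exact isClosedMap_fst_of_compactSpace _ (hK.preimage (by fun_prop))

/-- `P(c|Z| ≤ x)` for a standard Gaussian -/
def gG (c x : ℝ) : ENNReal := gaussianReal 0 1 {w : ℝ | c * |w| ≤ x}

lemma pi_gauss_event {ι : Type} [Fintype ι] [DecidableEq ι] (l : ι) (c : ℝ) :
    Measure.pi (fun _ : ι => gaussianReal 0 1)
      {z : ι → ℝ | z l ≠ 0 ∧ ∀ i, i ≠ l → c * |z i| ≤ |z l|} =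
    ∫⁻ x, gG c |x| ^ (Fintype.card ι - 1) ∂(gaussianReal 0 1) := by
  have hmp := measurePreserving_piEquivPiSubtypeProd
    (fun _ : ι => gaussianReal 0 1) (fun i => i = l)
  let T : Set (({i : ι // i = l} → ℝ) × ({i : ι // ¬ i = l} → ℝ)) :=
    {q | q.1 ⟨l, rfl⟩ ≠ 0 ∧ ∀ i, c * |q.2 i| ≤ |q.1 ⟨l, rfl⟩|}
  have hT : MeasurableSet T := by
    have : T = {q | q.1 ⟨l, rfl⟩ ≠ 0} ∩ ⋂ i, {q | c * |q.2 i| ≤ |q.1 ⟨l, rfl⟩|} := by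
      ext q; simp [T]
    rw [this]
    refine MeasurableSet.inter ?_ (MeasurableSet.iInter fun i => ?_)
    · exact (measurableSet_eq_fun (f := fun q : ({i : ι // i = l} → ℝ) × ({i : ι // ¬ i = l} → ℝ)
        => q.1 ⟨l, rfl⟩) (g := fun _ => 0) (by fun_prop) (by fun_prop)).compl
    · exact measurableSet_le (by fun_prop) (by fun_prop)
  have h1 : {z : ι → ℝ | z l ≠ 0 ∧ ∀ i, i ≠ l → c * |z i| ≤ |z l|} =
      (MeasurableEquiv.piEquivPiSubtypeProd (fun _ : ι => ℝ) (fun i => i = l)) ⁻¹' T := by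
    ext z
    simp [T, MeasurableEquiv.piEquivPiSubtypeProd]
  rw [h1, hmp.measure_preimage hT.nullMeasurableSet, Measure.prod_apply hT]
  have hev := @measurePreserving_eval {i : ι // i = l} (fun _ => ℝ) (Subtype.fintype _) _
    (fun _ : {i : ι // i = l} => gaussianReal 0 1) _ ⟨l, rfl⟩
  have hset : ∀ x : ℝ, {w : {i : ι // ¬ i = l} → ℝ | ∀ i, c * |w i| ≤ |x|} =
      Set.pi Set.univ (fun _ => {w : ℝ | c * |w| ≤ |x|}) := by
    intro x; ext w; simp
  have hcard : Fintype.card {i : ι // ¬ i = l} = Fintype.card ι - 1 := by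
    rw [Fintype.card_subtype_compl, Fintype.card_subtype_eq]
  have hmeas : Measurable (fun x : ℝ => gG c |x| ^ (Fintype.card ι - 1)) := by
    have hm0 : Monotone (gG c) := fun x y hxy => measure_mono fun w hw => le_trans hw hxy
    exact (hm0.measurable.comp measurable_abs).pow_const _
  rw [← hev.lintegral_comp hmeas]
  have hne : ∀ᵐ x ∂(gaussianReal 0 1), x ≠ 0 := by
    have := nullSingletonClass_gaussianReal (μ := 0) (v := 1) one_ne_zero
    rw [ae_iff]
    simp
  refine lintegral_congr_ae ?_
  filter_upwards [hev.quasiMeasurePreserving.ae hne] with x hx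
  have h3 : Prod.mk x ⁻¹' T = {w : {i : ι // ¬ i = l} → ℝ | ∀ i, c * |w i| ≤ |x ⟨l, rfl⟩|} := by
    ext w
    simp only [Set.mem_preimage, Set.mem_ofPred_eq, T]
    exact ⟨fun h => h.2, fun h => ⟨hx, h⟩⟩
  rw [h3, hset, Measure.pi_pi]
  simp [gG, hcard]

lemma gauss_event {ι : Type} [Fintype ι] [DecidableEq ι] (k : ℕ) (p : ι → Prop) [DecidablePred p]
    (l : ι) (hl : ¬ p l) (hcard : Fintype.card {i // p i} + 1 = k) (c : ℝ) (hc : 0 < c) :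
    gRows k ι {A | ∃ y, (∀ i, p i → inner ℝ (A i) y = 0) ∧ inner ℝ (A l) y = c ∧
      ∀ i, ¬ p i → i ≠ l → |inner ℝ (A i) y| ≤ 1} =
    ∫⁻ x, gG c |x| ^ (Fintype.card ι - k) ∂(gaussianReal 0 1) := by
  have hmp := measurePreserving_piEquivPiSubtypeProd
    (fun _ : ι => stdGaussian (EuclideanSpace ℝ (Fin k))) p
  let T : Set (({i : ι // p i} → EuclideanSpace ℝ (Fin k)) × ({i : ι // ¬ p i} → EuclideanSpace ℝ (Fin k))) :=
    {q | ∃ y : EuclideanSpace ℝ (Fin k), (q, y) ∈ {q : (({i : ι // p i} → EuclideanSpace ℝ (Fin k)) × ({i : ι // ¬ p i} → EuclideanSpace ℝ (Fin k))) × EuclideanSpace ℝ (Fin k) |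
      (∀ i, inner ℝ (q.1.1 i) q.2 = 0) ∧ inner ℝ (q.1.2 ⟨l, hl⟩) q.2 = c ∧
      ∀ i, i ≠ ⟨l, hl⟩ → |inner ℝ (q.1.2 i) q.2| ≤ 1}}
  have hT : MeasurableSet T := by
    refine measurableSet_exists_closed _ ?_
    simp only [Set.ofPred_and, Set.ofPred_forall]
    refine IsClosed.inter (isClosed_iInter fun i => isClosed_eq (by fun_prop) (by fun_prop))
      (IsClosed.inter (isClosed_eq (by fun_prop) (by fun_prop))
       (isClosed_iInter fun i => isClosed_iInter fun hi => isClosed_le (by fun_prop) (by fun_prop)))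
  have h1 : {A : ι → EuclideanSpace ℝ (Fin k) | ∃ y, (∀ i, p i → inner ℝ (A i) y = 0) ∧ inner ℝ (A l) y = c ∧
      ∀ i, ¬ p i → i ≠ l → |inner ℝ (A i) y| ≤ 1} =
      (MeasurableEquiv.piEquivPiSubtypeProd (fun _ : ι => EuclideanSpace ℝ (Fin k)) p) ⁻¹' T := by
    ext z
    simp [T, MeasurableEquiv.piEquivPiSubtypeProd]
  have hcard2 : Fintype.card {i : ι // ¬ p i} - 1 = Fintype.card ι - k := by
    rw [Fintype.card_subtype_compl]; omega
  rw [h1, gRows, hmp.measure_preimage hT.nullMeasurableSet, Measure.prod_apply hT, ← hcard2,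
    ← pi_gauss_event (⟨l, hl⟩ : {i : ι // ¬ p i}) c]
  have hae := ae_linearIndependent k {i // p i} (by omega)
  have : ∀ᵐ C ∂(Measure.pi fun _ : {i // p i} => stdGaussian (EuclideanSpace ℝ (Fin k))),
      (Measure.pi fun _ : {i // ¬ p i} => stdGaussian (EuclideanSpace ℝ (Fin k))) (Prod.mk C ⁻¹' T) =
      Measure.pi (fun _ : {i : ι // ¬ p i} => gaussianReal 0 1)
      {z | z ⟨l, hl⟩ ≠ 0 ∧ ∀ i, i ≠ ⟨l, hl⟩ → c * |z i| ≤ |z ⟨l, hl⟩|} := by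
    filter_upwards [hae] with C hC
    have hfr : Module.finrank ℝ (Submodule.span ℝ (Set.range C))ᗮ = 1 := by
      have h2 := Submodule.finrank_add_finrank_orthogonal (Submodule.span ℝ (Set.range C))
      rw [finrank_span_eq_card hC] at h2
      simp only [finrank_euclideanSpace, Fintype.card_fin] at h2
      omega
    obtain ⟨v, hv0, hv⟩ := finrank_eq_one_iff'.mp hfr
    have hv0' : (v : EuclideanSpace ℝ (Fin k)) ≠ 0 := by simpa using hv0
    have hvn : ‖(v : EuclideanSpace ℝ (Fin k))‖ ≠ 0 := norm_ne_zero_iff.mpr hv0'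
    set u : EuclideanSpace ℝ (Fin k) := ‖(v : EuclideanSpace ℝ (Fin k))‖⁻¹ • (v : EuclideanSpace ℝ (Fin k)) with hu_def
    have hu : ‖u‖ = 1 := by
      rw [hu_def, norm_smul, norm_inv, norm_norm, inv_mul_cancel₀ hvn]
    have hperp : ∀ i, inner ℝ (C i) u = 0 := by
      intro i
      have := (Submodule.mem_orthogonal _ (v : EuclideanSpace ℝ (Fin k))).mp v.2 (C i) (Submodule.subset_span ⟨i, rfl⟩)
      rw [hu_def, real_inner_smul_right, this, mul_zero]
    have hline : ∀ y : EuclideanSpace ℝ (Fin k), (∀ i, inner ℝ (C i) y = 0) → ∃ t : ℝ, y = t • u := by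
      intro y hy
      have hy' : y ∈ (Submodule.span ℝ (Set.range C))ᗮ := by
        rw [Submodule.mem_orthogonal]
        intro w hw
        induction hw using Submodule.span_induction with
        | mem x hx => obtain ⟨i, rfl⟩ := hx; exact hy i
        | zero => simp
        | add x y _ _ hx hy => rw [inner_add_left, hx, hy, add_zero]
        | smul a x _ hx => rw [real_inner_smul_left, hx, mul_zero]
      obtain ⟨t, ht⟩ := hv ⟨y, hy'⟩
      refine ⟨t * ‖(v : EuclideanSpace ℝ (Fin k))‖, ?_⟩
      have : t • (v : EuclideanSpace ℝ (Fin k)) = y := congrArg Subtype.val ht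
      rw [hu_def, smul_smul, mul_assoc, mul_inv_cancel₀ hvn, mul_one, this]
    have hmap : (Measure.pi fun _ : {i // ¬ p i} => stdGaussian (EuclideanSpace ℝ (Fin k))).map
        (fun B i => inner ℝ (B i) u) = Measure.pi (fun _ : {i : ι // ¬ p i} => gaussianReal 0 1) := by
      have := Measure.pi_map_pi (μ := fun _ : {i // ¬ p i} => stdGaussian (EuclideanSpace ℝ (Fin k)))
        (f := fun _ x => inner ℝ x u) (fun i => by fun_prop)
      rw [this]
      simp_rw [map_inner_stdGaussian u hu]
    have hmeasm : Measurable (fun (B : {i // ¬ p i} → EuclideanSpace ℝ (Fin k)) i => inner ℝ (B i) u) := by fun_prop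
    rw [← hmap, Measure.map_apply hmeasm]
    · congr 1
      ext B
      simp only [Set.mem_preimage, Set.mem_ofPred_eq, T]
      constructor
      · rintro ⟨y, hy, hyl, hyi⟩
        obtain ⟨t, rfl⟩ := hline y hy
        simp only [real_inner_smul_right] at hyl hyi
        have hne : inner ℝ (B ⟨l, hl⟩) u ≠ 0 := by
          intro h; rw [h, mul_zero] at hyl; exact hc.ne hyl
        refine ⟨hne, fun i hi => ?_⟩
        have := hyi i hi
        rw [abs_mul] at this
        have h3 : c = |t| * |inner ℝ (B ⟨l, hl⟩) u| := by
          rw [← abs_mul, hyl, abs_of_pos hc]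
        rw [h3]
        nlinarith [abs_nonneg (inner ℝ (B ⟨l, hl⟩) u)]
      · rintro ⟨hne, hi⟩
        refine ⟨(c / inner ℝ (B ⟨l, hl⟩) u) • u, fun i => ?_, ?_, fun i hi' => ?_⟩
        · rw [real_inner_smul_right, hperp, mul_zero]
        · rw [real_inner_smul_right, div_mul_cancel₀ _ hne]
        · rw [real_inner_smul_right, abs_mul, abs_div, abs_of_pos hc, div_mul_eq_mul_div,
            div_le_one (abs_pos.mpr hne)]
          exact hi i hi'
    · have : {z : {i // ¬ p i} → ℝ | z ⟨l, hl⟩ ≠ 0 ∧ ∀ i, i ≠ ⟨l, hl⟩ → c * |z i| ≤ |z ⟨l, hl⟩|} =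
          {z | z ⟨l, hl⟩ ≠ 0} ∩ ⋂ i, ⋂ (_ : i ≠ ⟨l, hl⟩), {z | c * |z i| ≤ |z ⟨l, hl⟩|} := by
        ext q; simp
      rw [this]
      refine MeasurableSet.inter ?_ (MeasurableSet.iInter fun i => MeasurableSet.iInter fun _ => ?_)
      · exact (measurableSet_eq_fun (f := fun q : {i // ¬ p i} → ℝ
          => q ⟨l, hl⟩) (g := fun _ => 0) (by fun_prop) (by fun_prop)).compl
      · exact measurableSet_le (by fun_prop) (by fun_prop)
  rw [lintegral_congr_ae this]
  simp

/-- The evaluation `y ↦ (⟪A i, y⟫)ᵢ`. -/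
def evalLin {n k : ℕ} (A : Fin n → EuclideanSpace ℝ (Fin k)) :
    EuclideanSpace ℝ (Fin k) →ₗ[ℝ] EuclideanSpace ℝ (Fin n) where
  toFun y := WithLp.toLp 2 (fun i => inner ℝ (A i) y)
  map_add' x y := by ext i; simp [inner_add_right]
  map_smul' c x := by ext i; simp [real_inner_smul_right]

@[simp] lemma evalLin_apply {n k : ℕ} (A : Fin n → EuclideanSpace ℝ (Fin k)) (y) (i : Fin n) :
    evalLin A y i = inner ℝ (A i) y := rfl

lemma evalLin_rowAct {n k : ℕ} (M : Matrix (Fin n) (Fin n) ℝ)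
    (A : Fin n → EuclideanSpace ℝ (Fin k)) (y) :
    evalLin (rowAct M A) y = Matrix.toEuclideanLin M (evalLin A y) := by
  ext i
  simp [rowAct, Matrix.toLpLin_apply, Matrix.mulVec, dotProduct, sum_inner, real_inner_smul_left]

/-- the inclusion of `ℝ^k` in `ℝ^n` -/
def inclLin {n k : ℕ} :
    EuclideanSpace ℝ (Fin k) →ₗ[ℝ] EuclideanSpace ℝ (Fin n) where
  toFun y := WithLp.toLp 2 (fun i => if h : (i : ℕ) < k then y ⟨i, h⟩ else 0)
  map_add' x y := by ext i; by_cases h : (i : ℕ) < k <;> simp [h]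
  map_smul' c x := by ext i; by_cases h : (i : ℕ) < k <;> simp [h]

lemma inclLin_norm {n k : ℕ} (hkn : k ≤ n) (y : EuclideanSpace ℝ (Fin k)) :
    ‖inclLin (n := n) y‖ = ‖y‖ := by
  rw [EuclideanSpace.norm_eq, EuclideanSpace.norm_eq]
  congr 1
  obtain ⟨m, rfl⟩ := Nat.exists_eq_add_of_le hkn
  rw [Fin.sum_univ_add]
  simp [inclLin]

lemma range_inclLin {n k : ℕ} (hkn : k ≤ n) :
    Set.range (inclLin (n := n) (k := k)) = Ek n k := by
  ext x
  constructor
  · rintro ⟨y, rfl⟩ i hi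
    simp [inclLin, not_lt.mpr hi]
  · intro hx
    refine ⟨WithLp.toLp 2 (fun j => x ⟨j, by omega⟩), ?_⟩
    ext i
    by_cases h : (i : ℕ) < k
    · simp [inclLin, h]
    · simp [inclLin, h, hx i (not_lt.mp h)]

lemma exists_orthogonal {n k : ℕ} (hkn : k ≤ n)
    (T : EuclideanSpace ℝ (Fin k) →ₗ[ℝ] EuclideanSpace ℝ (Fin n)) (hT : Function.Injective T) :
    ∃ O : OG n, act O '' Ek n k = Set.range T := by
  let J : EuclideanSpace ℝ (Fin k) →ₗᵢ[ℝ] EuclideanSpace ℝ (Fin n) := ⟨inclLin, inclLin_norm hkn⟩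
  have hfr : Module.finrank ℝ T.range = k := by
    rw [LinearMap.finrank_range_of_inj hT]; simp
  let L : EuclideanSpace ℝ (Fin k) ≃ₗᵢ[ℝ] T.range :=
    ((stdOrthonormalBasis ℝ T.range).reindex (finCongr hfr)).repr.symm
  let M : J.toLinearMap.range →ₗᵢ[ℝ] EuclideanSpace ℝ (Fin n) :=
    T.range.subtypeₗᵢ.comp (L.toLinearIsometry.comp J.equivRange.symm.toLinearIsometry)
  let X := M.extend
  have hX : ∀ y, X (J y) = L y := by
    intro y
    have h1 := M.extend_apply (J.equivRange y)
    have h2 : ((J.equivRange y : J.toLinearMap.range) : EuclideanSpace ℝ (Fin n)) = J y := rfl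
    rw [h2] at h1
    rw [h1]
    simp [M]
  let Om := Matrix.toEuclideanLin.symm X.toLinearMap
  have hOm : Matrix.toEuclideanLin Om = X.toLinearMap := by simp [Om]
  have horth : Om ∈ Matrix.orthogonalGroup (Fin n) ℝ := by
    rw [Matrix.mem_orthogonalGroup_iff']
    ext i j
    have h1 : ∀ a b, Om a b = X (EuclideanSpace.single b 1) a := by
      intro a b
      have : X (EuclideanSpace.single b 1) = Matrix.toEuclideanLin Om (EuclideanSpace.single b 1) := by
        rw [hOm]; rfl
      rw [this]
      simp [Matrix.toLpLin_apply]
    have h2 := X.inner_map_map (EuclideanSpace.single j (1:ℝ)) (EuclideanSpace.single i 1)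
    rw [PiLp.inner_apply] at h2
    simp only [RCLike.inner_apply, conj_trivial] at h2
    rw [Matrix.mul_apply]
    simp only [Matrix.transpose_apply, h1]
    rw [h2, EuclideanSpace.inner_single_left, Matrix.one_apply]
    simp [eq_comm]
  refine ⟨⟨Om, horth⟩, ?_⟩
  rw [← range_inclLin hkn, ← Set.range_comp]
  have h3 : (act (⟨Om, horth⟩ : OG n)) ∘ (inclLin (n := n) (k := k)) = fun y => (L y : EuclideanSpace ℝ (Fin n)) := by
    ext1 y
    simp only [Function.comp, act]
    rw [hOm]
    exact hX y
  rw [h3]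
  ext x
  constructor
  · rintro ⟨y, rfl⟩
    exact (L y).2
  · rintro ⟨y, rfl⟩
    exact ⟨L.symm ⟨T y, ⟨y, rfl⟩⟩, by simp⟩

lemma evalLin_injective {n k : ℕ} (A : Fin n → EuclideanSpace ℝ (Fin k)) (hkn : k ≤ n)
    (h : LinearIndependent ℝ (fun i : {i : Fin n // (i : ℕ) < k} => A i)) :
    Function.Injective (evalLin A) := by
  rw [injective_iff_map_eq_zero]
  intro y hy
  have hc : Fintype.card {i : Fin n // (i : ℕ) < k} = k := by
    have e : {i : Fin n // (i : ℕ) < k} ≃ Fin k :=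
      ⟨fun i => ⟨i.1, i.2⟩, fun j => ⟨⟨j, by omega⟩, j.2⟩, fun _ => rfl, fun _ => rfl⟩
    rw [Fintype.card_congr e, Fintype.card_fin]
  have hspan := h.span_eq_top_of_card_eq_finrank' (by rw [hc]; simp)
  have : y ∈ (⊤ : Submodule ℝ (EuclideanSpace ℝ (Fin k)))ᗮ := by
    rw [← hspan, Submodule.mem_orthogonal]
    intro w hw
    induction hw using Submodule.span_induction with
    | mem x hx =>
      obtain ⟨i, rfl⟩ := hx
      have : evalLin A y i = 0 := by rw [hy]; rfl
      exact this
    | zero => simp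
    | add x y _ _ hx hy => rw [inner_add_left, hx, hy, add_zero]
    | smul a x _ hx => rw [real_inner_smul_left, hx, mul_zero]
  simpa using this

lemma act_mul {n : ℕ} (g h : OG n) (x) : act (g * h) x = act g (act h x) := by
  simp [act, Matrix.toLpLin_apply]

instance compactSpace_OG (n : ℕ) : CompactSpace (OG n) := by
  refine (isCompact_iff_compactSpace (s := ((Matrix.orthogonalGroup (Fin n) ℝ :
    Submonoid (Matrix (Fin n) (Fin n) ℝ)) : Set (Matrix (Fin n) (Fin n) ℝ)))).mp ?_
  have hK : IsCompact (Set.pi Set.univ (fun _ : Fin n => Set.pi Set.univ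
      (fun _ : Fin n => Set.Icc (-1 : ℝ) 1))) :=
    isCompact_univ_pi fun _ => isCompact_univ_pi fun _ => isCompact_Icc
  refine hK.of_isClosed_subset ?_ ?_
  · have : ((Matrix.orthogonalGroup (Fin n) ℝ : Submonoid (Matrix (Fin n) (Fin n) ℝ)) :
        Set (Matrix (Fin n) (Fin n) ℝ)) = {M | M * M.transpose = 1} := by
      ext M
      exact Matrix.mem_orthogonalGroup_iff _ _
    rw [this]
    exact isClosed_eq (by fun_prop) (by fun_prop)
  · intro M hM i _ j _
    have := entry_norm_bound_of_unitary (𝕜 := ℝ) hM i j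
    rw [Real.norm_eq_abs] at this
    exact abs_le.mp this

lemma map_mul_right_haar {n : ℕ} (H : Measure (OG n)) [H.IsHaarMeasure] [IsProbabilityMeasure H]
    (O : OG n) : H.map (· * O) = H := by
  have := Measure.isProbabilityMeasure_map (μ := H) (f := (· * O)) (by fun_prop)
  have : (H.map (· * O)).IsHaarMeasure := inferInstance
  exact Measure.isHaarMeasure_eq_of_isProbabilityMeasure _ _

lemma isClosed_cubeFace (n m : ℕ) : IsClosed (cubeFace n m) := by
  have : cubeFace n m = (⋂ i : Fin n, ⋂ (_ : (i : ℕ) < m), {x | |x i| ≤ 1}) ∩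
      ⋂ i : Fin n, ⋂ (_ : m ≤ (i : ℕ)), {x | x i = 1} := by
    ext x; simp [cubeFace]
  rw [this]
  exact IsClosed.inter
    (isClosed_iInter fun i => isClosed_iInter fun hi => isClosed_le (by fun_prop) (by fun_prop))
    (isClosed_iInter fun i => isClosed_iInter fun hi => isClosed_eq (by fun_prop) (by fun_prop))

lemma continuous_entry {n : ℕ} (i j : Fin n) :
    Continuous (fun g : OG n => (g : Matrix (Fin n) (Fin n) ℝ) i j) :=
  (continuous_apply_apply i j).comp
    (continuous_subtype_val : Continuous (Subtype.val : OG n → Matrix (Fin n) (Fin n) ℝ))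

lemma continuous_eval_rowAct {n k : ℕ} : Continuous
    (fun q : (OG n × (Fin n → EuclideanSpace ℝ (Fin k))) × EuclideanSpace ℝ (Fin k) =>
      evalLin (rowAct (q.1.1 : Matrix (Fin n) (Fin n) ℝ) q.1.2) q.2) := by
  have : Continuous
    (fun q : (OG n × (Fin n → EuclideanSpace ℝ (Fin k))) × EuclideanSpace ℝ (Fin k) =>
      (fun i : Fin n => inner ℝ (∑ j, (q.1.1 : Matrix (Fin n) (Fin n) ℝ) i j • q.1.2 j) q.2)) := by
    refine continuous_pi fun i => Continuous.inner ?_ (by fun_prop)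
    refine continuous_finsetSum _ fun j _ => ?_
    have h1 : Continuous (fun q : (OG n × (Fin n → EuclideanSpace ℝ (Fin k))) ×
        EuclideanSpace ℝ (Fin k) => (q.1.1 : Matrix (Fin n) (Fin n) ℝ) i j) :=
      (continuous_entry i j).comp (continuous_fst.comp continuous_fst)
    have h2 : Continuous (fun q : (OG n × (Fin n → EuclideanSpace ℝ (Fin k))) ×
        EuclideanSpace ℝ (Fin k) => q.1.2 j) :=
      (continuous_apply j).comp (continuous_snd.comp continuous_fst)
    exact h1.smul h2
  exact (PiLp.continuous_toLp 2 _).comp this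

lemma haar_eq_gauss {n k : ℕ} (hkn : k ≤ n) (H : Measure (OG n)) [H.IsHaarMeasure]
    [IsProbabilityMeasure H] (F : Set (EuclideanSpace ℝ (Fin n))) (hF : IsClosed F) :
    H {g | (act g '' Ek n k ∩ F).Nonempty} =
      gRows k (Fin n) {A | ∃ y, evalLin A y ∈ F} := by
  let T : Set (OG n × (Fin n → EuclideanSpace ℝ (Fin k))) :=
    {q | ∃ y, (q, y) ∈ {q : (OG n × (Fin n → EuclideanSpace ℝ (Fin k))) × EuclideanSpace ℝ (Fin k) |
      evalLin (rowAct (q.1.1 : Matrix (Fin n) (Fin n) ℝ) q.1.2) q.2 ∈ F}}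
  have hT : MeasurableSet T :=
    measurableSet_exists_closed _ (hF.preimage continuous_eval_rowAct)
  have hS : MeasurableSet {g : OG n | (act g '' Ek n k ∩ F).Nonempty} := by
    have : {g : OG n | (act g '' Ek n k ∩ F).Nonempty} =
        {g | ∃ y, (g, y) ∈ {q : OG n × EuclideanSpace ℝ (Fin n) |
          q.2 ∈ Ek n k ∧ act q.1 q.2 ∈ F}} := by
      ext g
      constructor
      · rintro ⟨_, ⟨y, hy, rfl⟩, hy2⟩
        exact ⟨y, hy, hy2⟩
      · rintro ⟨y, hy, hy2⟩
        exact ⟨_, ⟨y, hy, rfl⟩, hy2⟩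
    rw [this]
    refine measurableSet_exists_closed _ (IsClosed.inter ?_ (hF.preimage ?_))
    · have : {q : OG n × EuclideanSpace ℝ (Fin n) | q.2 ∈ Ek n k} =
        ⋂ i : Fin n, ⋂ (_ : k ≤ (i : ℕ)), {q | q.2 i = 0} := by
        ext x; simp [Ek]
      change IsClosed {q : OG n × EuclideanSpace ℝ (Fin n) | q.2 ∈ Ek n k}
      rw [this]
      exact (isClosed_iInter fun i => isClosed_iInter fun hi => isClosed_eq (by fun_prop) (by fun_prop))
    · have : Continuous (fun q : OG n × EuclideanSpace ℝ (Fin n) =>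
          fun i : Fin n => ∑ j, (q.1 : Matrix (Fin n) (Fin n) ℝ) i j * q.2 j) := by
        refine continuous_pi fun i => continuous_finsetSum _ fun j _ => Continuous.mul ?_ (by fun_prop)
        exact (continuous_entry i j).comp continuous_fst
      have h2 := (PiLp.continuous_toLp 2 _).comp this
      exact h2
  have h1 := Measure.prod_apply (μ := H) (ν := gRows k (Fin n)) hT
  have h2 := Measure.prod_apply_symm (μ := H) (ν := gRows k (Fin n)) hT
  rw [h1] at h2
  have hG : MeasurableSet {A : Fin n → EuclideanSpace ℝ (Fin k) | ∃ y, evalLin A y ∈ F} := by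
    refine measurableSet_exists_closed {q : (Fin n → EuclideanSpace ℝ (Fin k)) ×
      EuclideanSpace ℝ (Fin k) | evalLin q.1 q.2 ∈ F} (hF.preimage ?_)
    refine (PiLp.continuous_toLp 2 _).comp (continuous_pi fun i => ?_)
    fun_prop
  have h3 : ∀ g : OG n, gRows k (Fin n) (Prod.mk g ⁻¹' T) =
      gRows k (Fin n) {A | ∃ y, evalLin A y ∈ F} := by
    intro g
    have hg : (g : Matrix (Fin n) (Fin n) ℝ).transpose * (g : Matrix (Fin n) (Fin n) ℝ) = 1 :=
      by
      have := g.2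
      rw [Matrix.mem_orthogonalGroup_iff'] at this
      exact this
    conv_rhs => rw [← map_rowAct (k := k) (g : Matrix (Fin n) (Fin n) ℝ) hg,
      Measure.map_apply (measurable_rowAct _) hG]
    rfl
  have h4 : ∀ᵐ A ∂(gRows k (Fin n)), H ((fun g => (g, A)) ⁻¹' T) =
      H {g | (act g '' Ek n k ∩ F).Nonempty} := by
    have hc : Fintype.card {i : Fin n // (i : ℕ) < k} ≤ k := by
      have e : {i : Fin n // (i : ℕ) < k} ≃ Fin k :=
        ⟨fun i => ⟨i.1, i.2⟩, fun j => ⟨⟨j, by omega⟩, j.2⟩, fun _ => rfl, fun _ => rfl⟩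
      rw [Fintype.card_congr e, Fintype.card_fin]
    filter_upwards [ae_linearIndependent_sub k (Fin n) (fun i => (i : ℕ) < k) hc] with A hA
    obtain ⟨O, hO⟩ := exists_orthogonal hkn (evalLin A) (evalLin_injective A hkn hA)
    conv_rhs => rw [← map_mul_right_haar H O, Measure.map_apply (by fun_prop) hS]
    congr 1
    ext g
    constructor
    · rintro ⟨y, hy⟩
      have : evalLin (rowAct (g : Matrix (Fin n) (Fin n) ℝ) A) y ∈ F := hy
      rw [evalLin_rowAct] at this
      have h5 : evalLin A y ∈ act O '' Ek n k := by rw [hO]; exact ⟨y, rfl⟩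
      obtain ⟨x, hx, hxy⟩ := h5
      refine ⟨act g (evalLin A y), ⟨x, hx, ?_⟩, this⟩
      rw [act_mul, hxy]
    · rintro ⟨_, ⟨x, hx, rfl⟩, hxF⟩
      rw [act_mul] at hxF
      have h5 : act O x ∈ Set.range (evalLin A) := by rw [← hO]; exact ⟨x, hx, rfl⟩
      obtain ⟨y, hy⟩ := h5
      refine ⟨y, ?_⟩
      change evalLin (rowAct (g : Matrix (Fin n) (Fin n) ℝ) A) y ∈ F
      rw [evalLin_rowAct, hy]
      exact hxF
  rw [lintegral_congr_ae h4, lintegral_congr h3] at h2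
  simpa using h2.symm

/-- Householder reflection -/
def houseM {n : ℕ} (d : Fin n → ℝ) : Matrix (Fin n) (Fin n) ℝ :=
  1 - (2 / (d ⬝ᵥ d)) • Matrix.vecMulVec d d

lemma houseM_mulVec {n : ℕ} (d x : Fin n → ℝ) :
    (houseM d).mulVec x = x - (2 / (d ⬝ᵥ d) * (d ⬝ᵥ x)) • d := by
  rw [houseM, Matrix.sub_mulVec, Matrix.one_mulVec, Matrix.smul_mulVec, Matrix.vecMulVec_mulVec]
  ext i
  simp
  ring

lemma houseM_sq {n : ℕ} (d : Fin n → ℝ) : houseM d * houseM d = 1 := by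
  rw [houseM, sub_mul, mul_sub, mul_sub, one_mul, mul_one, Matrix.one_mul, Matrix.smul_mul, Matrix.mul_smul,
    Matrix.vecMulVec_mul_vecMulVec]
  by_cases h : d ⬝ᵥ d = 0
  · simp [h]
  · ext i j
    simp [Matrix.vecMulVec_apply]
    field_simp
    ring

lemma houseM_transpose {n : ℕ} (d : Fin n → ℝ) : (houseM d).transpose = houseM d := by
  ext i j
  simp [houseM, Matrix.vecMulVec_apply, Matrix.one_apply, eq_comm, mul_comm]

lemma houseM_add {n : ℕ} (d x : Fin n → ℝ) (h : d ⬝ᵥ x = - (d ⬝ᵥ d) / 2) :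
    (houseM d).mulVec x = x + d := by
  rw [houseM_mulVec]
  by_cases h0 : d ⬝ᵥ d = 0
  · have := dotProduct_self_eq_zero.mp h0
    simp [this]
  · rw [h]
    have : 2 / (d ⬝ᵥ d) * (-(d ⬝ᵥ d) / 2) = -1 := by field_simp
    rw [this]; simp

lemma houseM_sub {n : ℕ} (d x : Fin n → ℝ) (h : d ⬝ᵥ x = (d ⬝ᵥ d) / 2) :
    (houseM d).mulVec x = x - d := by
  rw [houseM_mulVec]
  by_cases h0 : d ⬝ᵥ d = 0
  · have := dotProduct_self_eq_zero.mp h0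
    simp [this]
  · rw [h]
    have : 2 / (d ⬝ᵥ d) * ((d ⬝ᵥ d) / 2) = 1 := by field_simp
    rw [this]; simp

lemma card_ge {n k : ℕ} (hkn : k ≤ n) : Fintype.card {i : Fin n // n - k ≤ (i : ℕ)} = k := by
  have e : {i : Fin n // n - k ≤ (i : ℕ)} ≃ Fin k :=
    ⟨fun i => ⟨i.1 - (n - k), by omega⟩, fun j => ⟨⟨j + (n - k), by omega⟩, by simp⟩,
      fun i => by ext; simp; omega, fun j => by ext; simp⟩
  rw [Fintype.card_congr e, Fintype.card_fin]

lemma face_rotate {n k : ℕ} (hk : 1 ≤ k) (hkn : k ≤ n) (l : Fin n) (hl : n - k ≤ (l : ℕ)) :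
    ∃ R : Matrix (Fin n) (Fin n) ℝ, R.transpose * R = 1 ∧ ∀ x : Fin n → ℝ,
      ((∀ i : Fin n, (i : ℕ) < n - k → |x i| ≤ 1) ∧ ∀ i : Fin n, n - k ≤ (i : ℕ) → x i = 1) ↔
      ((∀ i : Fin n, (n - k ≤ (i : ℕ) ∧ i ≠ l) → R.mulVec x i = 0) ∧
        R.mulVec x l = Real.sqrt k ∧
        ∀ i : Fin n, ¬ (n - k ≤ (i : ℕ) ∧ i ≠ l) → i ≠ l → |R.mulVec x i| ≤ 1) := by
  let v : Fin n → ℝ := fun i => if i = l then Real.sqrt k else 0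
  let w : Fin n → ℝ := fun i => if n - k ≤ (i : ℕ) then 1 else 0
  let d := v - w
  have hsq : Real.sqrt k * Real.sqrt k = k := Real.mul_self_sqrt (by positivity)
  have hvx : ∀ x : Fin n → ℝ, v ⬝ᵥ x = Real.sqrt k * x l := by
    intro x; simp [v, dotProduct]
  have hww : w ⬝ᵥ w = k := by
    simp only [w, dotProduct, mul_ite, mul_one, mul_zero]
    rw [← Finset.sum_filter, Finset.sum_ite_of_true (by simp)]
    simp only [Finset.sum_const, nsmul_eq_mul, mul_one]
    rw [← Fintype.card_subtype, card_ge hkn]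
  have hw1 : ∀ i : Fin n, n - k ≤ (i : ℕ) → w i = 1 := fun i hi => if_pos hi
  have hw0 : ∀ i : Fin n, ¬ n - k ≤ (i : ℕ) → w i = 0 := fun i hi => if_neg hi
  have hwl : w l = 1 := hw1 l hl
  have hvl : v l = Real.sqrt k := by simp [v]
  have hwx1 : ∀ x : Fin n → ℝ, (∀ i : Fin n, n - k ≤ (i : ℕ) → x i = 1) → w ⬝ᵥ x = k := by
    intro x hx
    rw [← hww]
    refine Finset.sum_congr rfl fun i _ => ?_
    by_cases hi : n - k ≤ (i : ℕ)
    · rw [hw1 i hi, hx i hi]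
    · rw [hw0 i hi, zero_mul, zero_mul]
  have hwx2 : ∀ x : Fin n → ℝ, (∀ i : Fin n, (n - k ≤ (i : ℕ) ∧ i ≠ l) → x i = 0) →
      w ⬝ᵥ x = x l := by
    intro x hx
    rw [dotProduct, Finset.sum_eq_single l]
    · rw [hwl, one_mul]
    · intro i _ hi
      by_cases h2 : n - k ≤ (i : ℕ)
      · rw [hx i ⟨h2, hi⟩, mul_zero]
      · rw [hw0 i h2, zero_mul]
    · simp
  have hdd : d ⬝ᵥ d = 2 * (k - Real.sqrt k) := by
    simp only [d, sub_dotProduct, dotProduct_sub]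
    rw [dotProduct_comm w v, hvx, hvx, hww, hvl, hwl, hsq]
    ring
  refine ⟨houseM d, by rw [houseM_transpose, houseM_sq], fun x => ⟨?_, ?_⟩⟩
  · rintro ⟨h1, h2⟩
    have h3 : (houseM d).mulVec x = x + d := by
      apply houseM_add
      rw [hdd]
      simp only [d, sub_dotProduct]
      rw [hvx, hwx1 x h2, h2 l hl]; ring
    rw [h3]
    refine ⟨fun i hi => ?_, ?_, fun i hi hil => ?_⟩
    · simp [d, v, hw1 i hi.1, hi.2, h2 i hi.1]
    · simp [d, hvl, hwl, h2 l hl]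
    · have hi2 : ¬ n - k ≤ (i : ℕ) := fun h => hi ⟨h, hil⟩
      have := h1 i (not_le.mp hi2)
      simpa [d, v, hil, hw0 i hi2] using this
  · rintro ⟨h1, h2, h3⟩
    set x' := (houseM d).mulVec x with hx'
    have hx : x = (houseM d).mulVec x' := by
      rw [hx', Matrix.mulVec_mulVec, houseM_sq, Matrix.one_mulVec]
    have h4 : (houseM d).mulVec x' = x' - d := by
      apply houseM_sub
      rw [hdd]
      simp only [d, sub_dotProduct]
      rw [hvx, hwx2 x' h1, h2, hsq]; ring
    rw [hx, h4]
    refine ⟨fun i hi => ?_, fun i hi => ?_⟩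
    · have hil : i ≠ l := by rintro rfl; omega
      have := h3 i (fun h => by omega) hil
      simpa [d, v, hil, hw0 i (not_le.mpr hi)] using this
    · by_cases hil : i = l
      · subst hil; simp [d, hvl, hwl, h2]
      · simp [d, v, hil, hw1 i hi, h1 i ⟨hi, hil⟩]

lemma haar_prob {n k : ℕ} (hk : 1 ≤ k) (hkn : k ≤ n) (H : Measure (OG n)) [H.IsHaarMeasure]
    [IsProbabilityMeasure H] :
    H {g | (act g '' Ek n k ∩ cubeFace n (n - k + 0)).Nonempty} =
      ∫⁻ x, gG (Real.sqrt k) |x| ^ (n - k) ∂(gaussianReal 0 1) := by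
  rw [haar_eq_gauss hkn H _ (isClosed_cubeFace _ _), add_zero]
  have hn : n - 1 < n := by omega
  obtain ⟨R, hR, hRx⟩ := face_rotate hk hkn ⟨n - 1, hn⟩ (by simp; omega)
  set l : Fin n := ⟨n - 1, hn⟩ with hl
  have hcard : Fintype.card {i : Fin n // n - k ≤ (i : ℕ) ∧ i ≠ l} + 1 = k := by
    have h1 := card_ge hkn
    rw [Fintype.card_subtype] at h1 ⊢
    have h2 : (Finset.univ.filter fun i : Fin n => n - k ≤ (i : ℕ) ∧ i ≠ l) =
        (Finset.univ.filter fun i : Fin n => n - k ≤ (i : ℕ)).erase l := by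
      ext i; simp [and_comm]
    rw [h2, Finset.card_erase_of_mem (by simp [hl]; omega), h1]
    omega
  have hge := gauss_event (ι := Fin n) k (fun i => n - k ≤ (i : ℕ) ∧ i ≠ l) l (by simp) hcard
    (Real.sqrt k) (by positivity)
  rw [Fintype.card_fin] at hge
  rw [← hge]
  conv_rhs => rw [← map_rowAct (k := k) R hR]
  have hev : ∀ (A : Fin n → EuclideanSpace ℝ (Fin k)) y i,
      inner ℝ (rowAct R A i) y = R.mulVec (fun j => inner ℝ (A j) y) i := by
    intro A y i
    simp [rowAct, Matrix.mulVec, dotProduct, sum_inner, real_inner_smul_left]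
  rw [Measure.map_apply (measurable_rowAct _)]
  · congr 1
    ext A
    refine exists_congr fun y => ?_
    have := hRx (fun j => inner ℝ (A j) y)
    simp only [← hev] at this
    exact this
  · refine measurableSet_exists_closed {q : (Fin n → EuclideanSpace ℝ (Fin k)) ×
      EuclideanSpace ℝ (Fin k) | (∀ i : Fin n, (n - k ≤ (i : ℕ) ∧ i ≠ l) → inner ℝ (q.1 i) q.2 = 0) ∧
      inner ℝ (q.1 l) q.2 = Real.sqrt k ∧
      ∀ i : Fin n, ¬ (n - k ≤ (i : ℕ) ∧ i ≠ l) → i ≠ l → |inner ℝ (q.1 i) q.2| ≤ 1} ?_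
    simp only [Set.ofPred_and, Set.ofPred_forall]
    refine IsClosed.inter (isClosed_iInter fun i => isClosed_iInter fun hi =>
      isClosed_eq (by fun_prop) (by fun_prop))
      (IsClosed.inter (isClosed_eq (by fun_prop) (by fun_prop))
       (isClosed_iInter fun i => isClosed_iInter fun hi => isClosed_iInter fun hi =>
        isClosed_le (by fun_prop) (by fun_prop)))

/-! ### Part 2: asymptotics -/

def MM (t : ℝ) : ℝ := ∫ s in Set.Ioi (0:ℝ), rexp (-(t * s) - s ^ 2 / 2)

def psi (t : ℝ) : ℝ := 2 / √(2 * π) * rexp (-t ^ 2 / 2) * MM t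

def QQ (t : ℝ) : ℝ := (gG 1 t).toReal

lemma gG_mono (c : ℝ) : Monotone (gG c) :=
  fun _ _ hxy => measure_mono fun _ hw => le_trans hw hxy

lemma gG_le_one (c x : ℝ) : gG c x ≤ 1 := prob_le_one

lemma gG_ne_top (c x : ℝ) : gG c x ≠ ⊤ := ((gG_le_one c x).trans_lt ENNReal.one_lt_top).ne

lemma gG_scale {c : ℝ} (hc : 0 < c) (x : ℝ) : gG c x = gG 1 (x / c) := by
  unfold gG
  congr 1
  ext w
  simp only [Set.mem_ofPred_eq, one_mul]
  rw [le_div_iff₀ hc, mul_comm]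

lemma QQ_mono : Monotone QQ := fun _ _ hxy =>
  ENNReal.toReal_mono (gG_ne_top _ _) (gG_mono 1 hxy)

lemma QQ_nonneg (t : ℝ) : 0 ≤ QQ t := ENNReal.toReal_nonneg

lemma QQ_le_one (t : ℝ) : QQ t ≤ 1 := by
  have := ENNReal.toReal_mono ENNReal.one_ne_top (gG_le_one 1 t)
  simpa [QQ] using this

lemma MM_integrable {t : ℝ} (ht : 0 ≤ t) :
    IntegrableOn (fun s : ℝ => rexp (-(t * s) - s ^ 2 / 2)) (Set.Ioi 0) := by
  have h : Integrable (fun s : ℝ => rexp (-(1/2) * s ^ 2)) :=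
    integrable_exp_neg_mul_sq (by norm_num)
  refine Integrable.mono' h.integrableOn (by fun_prop) ?_
  refine (ae_restrict_iff' measurableSet_Ioi).2 (ae_of_all _ fun s hs => ?_)
  rw [Real.norm_eq_abs, abs_of_pos (exp_pos _)]
  apply Real.exp_le_exp.2
  have : 0 ≤ t * s := mul_nonneg ht (le_of_lt hs)
  linarith

lemma MM_nonneg (t : ℝ) : 0 ≤ MM t := integral_nonneg fun _ => (exp_pos _).le

lemma MM_lower {t : ℝ} (ht : 0 ≤ t) : rexp (-(3/2)) / (1 + t) ≤ MM t := by
  have h1 : ∫ s in Set.Ioc (0:ℝ) (1 / (1 + t)), rexp (-(3/2)) ≤ MM t := by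
    refine le_trans ?_ (setIntegral_mono_set (s := Set.Ioc (0:ℝ) (1 / (1 + t))) (MM_integrable ht)
      (ae_of_all _ fun _ => (exp_pos _).le)
      (LE.le.eventuallyLE (Set.Ioc_subset_Ioi_self)))
    refine setIntegral_mono_on (by simp)
      ((MM_integrable ht).mono_set Set.Ioc_subset_Ioi_self) measurableSet_Ioc ?_
    intro s hs
    apply Real.exp_le_exp.2
    have h2 : s * (1 + t) ≤ 1 := by
      have := hs.2
      rwa [le_div_iff₀ (by linarith)] at this
    have h3 : 0 ≤ s * t := mul_nonneg hs.1.le ht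
    have h0 := hs.1
    nlinarith
  have h4 : (0:ℝ) ≤ 1 / (1 + t) := by positivity
  simp only [integral_const, MeasurableSet.univ, measureReal_restrict_apply, Set.univ_inter,
    Real.volume_real_Ioc_of_le h4, smul_eq_mul] at h1
  calc _ = (1 / (1 + t) - 0) * rexp (-(3/2)) := by ring
    _ ≤ _ := h1

lemma MM_tendsto : Tendsto (fun t : ℝ => t * MM t) atTop (nhds 1) := by
  have h1 : (fun t : ℝ => ∫ r in Set.Ioi (0:ℝ), rexp (-r - r ^ 2 / (2 * t ^ 2))) =ᶠ[atTop]
      fun t : ℝ => t * MM t := by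
    filter_upwards [eventually_gt_atTop 0] with t ht
    have := integral_comp_mul_left_Ioi (fun r : ℝ => rexp (-r - r ^ 2 / (2 * t ^ 2))) 0 ht
    rw [mul_zero] at this
    have h2 : MM t = t⁻¹ • ∫ x in Set.Ioi (0:ℝ), rexp (-x - x ^ 2 / (2 * t ^ 2)) := by
      rw [← this]
      unfold MM
      congr 1
      ext s
      congr 1
      field_simp
    rw [h2, smul_eq_mul, mul_inv_cancel_left₀ ht.ne']
  refine Tendsto.congr' h1 ?_
  have h3 : (1:ℝ) = ∫ r in Set.Ioi (0:ℝ), rexp (-r) := integral_exp_neg_Ioi_zero.symm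
  rw [h3]
  refine tendsto_integral_filter_of_dominated_convergence (fun r => rexp (-r)) ?_ ?_
    (integrableOn_exp_neg_Ioi 0) ?_
  · exact Eventually.of_forall fun t => by fun_prop
  · refine Eventually.of_forall fun t => ae_of_all _ fun r => ?_
    rw [Real.norm_eq_abs, abs_of_pos (exp_pos _)]
    apply Real.exp_le_exp.2
    have : 0 ≤ r ^ 2 / (2 * t ^ 2) := by positivity
    linarith
  · refine ae_of_all _ fun r => ?_
    refine (Real.continuous_exp.tendsto _).comp ?_
    have : Tendsto (fun t : ℝ => r ^ 2 / (2 * t ^ 2)) atTop (nhds 0) :=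
      Tendsto.div_atTop tendsto_const_nhds
        ((tendsto_pow_atTop two_ne_zero).const_mul_atTop two_pos)
    simpa using this.const_sub (-r)

lemma QQ_eq {t : ℝ} (ht : 0 ≤ t) : QQ t = 1 - psi t := by
  have hms : MeasurableSet {w : ℝ | 1 * |w| ≤ t} :=
    (isClosed_le (by fun_prop) (by fun_prop)).measurableSet
  have h1 : QQ t = 1 - (gaussianReal 0 1).real {w : ℝ | 1 * |w| ≤ t}ᶜ := by
    rw [probReal_compl_eq_one_sub hms]
    simp [QQ, gG, Measure.real]
  rw [h1]
  congr 1
  rw [Measure.real, gaussianReal_apply_eq_integral _ one_ne_zero, ENNReal.toReal_ofReal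
    (integral_nonneg fun _ => gaussianPDFReal_nonneg _ _ _), ← integral_indicator hms.compl]
  set h : ℝ → ℝ := (Set.Ioi t).indicator (fun y => (√(2 * π))⁻¹ * rexp (-y ^ 2 / 2)) with hh
  have h2 : ({w : ℝ | 1 * |w| ≤ t}ᶜ.indicator (gaussianPDFReal 0 1)) = fun x => h |x| := by
    ext x
    simp only [hh, Set.indicator_apply, Set.mem_compl_iff, Set.mem_ofPred_eq, one_mul, not_le,
      Set.mem_Ioi, gaussianPDFReal_def, sub_zero, NNReal.coe_one, mul_one, sq_abs]
  rw [h2, integral_comp_abs, hh, setIntegral_indicator measurableSet_Ioi, Set.Ioi_inter_Ioi,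
    sup_eq_right.2 ht]
  have h3 : ∫ y in Set.Ioi t, (√(2 * π))⁻¹ * rexp (-y ^ 2 / 2) =
      ∫ s in Set.Ioi (0:ℝ), (√(2 * π))⁻¹ * rexp (-(s + t) ^ 2 / 2) := by
    rw [← integral_indicator measurableSet_Ioi, ← integral_indicator measurableSet_Ioi,
      ← integral_add_right_eq_self _ t]
    congr 1
    ext s
    simp [Set.indicator_apply]
  rw [h3, psi, MM, ← integral_const_mul, ← integral_const_mul]
  congr 1
  ext s
  have h4 : rexp (-(s + t) ^ 2 / 2) = rexp (-t ^ 2 / 2) * rexp (-(t * s) - s ^ 2 / 2) := by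
    rw [← Real.exp_add]
    congr 1
    ring
  rw [h4]
  ring

lemma psi_nonneg (t : ℝ) : 0 ≤ psi t := by
  have := MM_nonneg t
  unfold psi
  positivity

def IsB (b : ℝ) (N : ℕ) : Prop := 0 ≤ b ∧ √(2 * π) * b * rexp (b ^ 2 / 2) = 2 * N

lemma sqrt_two_pi_ge_one : 1 ≤ √(2 * π) := by
  rw [Real.one_le_sqrt]
  have := Real.pi_gt_three
  linarith

lemma exists_IsB (N : ℕ) : ∃ b, IsB b N := by
  have hc : ContinuousOn (fun b : ℝ => √(2 * π) * b * rexp (b ^ 2 / 2)) (Set.Icc 0 (2 * N)) := by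
    fun_prop
  have hN : (0:ℝ) ≤ 2 * N := by positivity
  have := intermediate_value_Icc hN hc
  have h2 : (2 * N : ℝ) ∈ Set.Icc ((fun b : ℝ => √(2 * π) * b * rexp (b ^ 2 / 2)) 0)
      ((fun b : ℝ => √(2 * π) * b * rexp (b ^ 2 / 2)) (2 * N)) := by
    refine ⟨by simp, ?_⟩
    have h1 : 1 ≤ rexp ((2 * N : ℝ) ^ 2 / 2) := Real.one_le_exp (by positivity)
    calc (2 * N : ℝ) = 1 * (2 * N) * 1 := by ring
      _ ≤ _ := by
        have := sqrt_two_pi_ge_one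
        dsimp only
        gcongr
  obtain ⟨b, hb, hb2⟩ := this h2
  exact ⟨b, hb.1, hb2⟩

def bN (N : ℕ) : ℝ := (exists_IsB N).choose

lemma bN_spec (N : ℕ) : IsB (bN N) N := (exists_IsB N).choose_spec

lemma bN_tendsto : Tendsto bN atTop atTop := by
  refine tendsto_atTop.2 fun M => ?_
  have h := tendsto_natCast_atTop_atTop (R := ℝ)
  filter_upwards [h.eventually_gt_atTop (√(2 * π) * |M| * rexp (|M| ^ 2 / 2) / 2)] with N hN
  by_contra hlt
  push Not at hlt
  obtain ⟨h0, h1⟩ := bN_spec N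
  have h2 : bN N ≤ |M| := hlt.le.trans (le_abs_self M)
  have : √(2 * π) * bN N * rexp (bN N ^ 2 / 2) ≤ √(2 * π) * |M| * rexp (|M| ^ 2 / 2) := by
    gcongr
  linarith

lemma log_N_eq {b : ℝ} {N : ℕ} (h : IsB b N) (hb : 0 < b) :
    Real.log N = b ^ 2 / 2 + Real.log b + Real.log (√(2 * π) / 2) := by
  have h1 : (N : ℝ) = √(2 * π) / 2 * b * rexp (b ^ 2 / 2) := by
    have := h.2
    linarith
  have := sqrt_two_pi_ge_one
  rw [h1, Real.log_mul (by positivity) (by positivity), Real.log_mul (by positivity) hb.ne',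
    Real.log_exp]
  ring

lemma log_div_b : Tendsto (fun N : ℕ => Real.log N / (bN N ^ 2 / 2)) atTop (nhds 1) := by
  have h1 : Tendsto (fun b : ℝ => 1 + 2 * (Real.log b / b ^ 2) +
      Real.log (√(2 * π) / 2) / (b ^ 2 / 2)) atTop (nhds (1 + 2 * 0 + 0)) := by
    refine (Tendsto.add tendsto_const_nhds (Tendsto.const_mul _ ?_)).add ?_
    · have := (isLittleO_log_rpow_atTop (r := 2) two_pos).tendsto_div_nhds_zero
      simpa using this
    · exact Tendsto.div_atTop tendsto_const_nhds
        ((tendsto_pow_atTop two_ne_zero).atTop_div_const two_pos)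
  have h2 := h1.comp bN_tendsto
  simp only [mul_zero, add_zero] at h2
  refine h2.congr' ?_
  filter_upwards [bN_tendsto.eventually_gt_atTop 0] with N hN
  rw [log_N_eq (bN_spec N) hN]
  simp only [Function.comp]
  field_simp

lemma Npsi {b : ℝ} {N : ℕ} (h : IsB b N) (hb : 0 < b) (s : ℝ) :
    N * psi (b + s / b) = b * rexp (-s - s ^ 2 / (2 * b ^ 2)) * MM (b + s / b) := by
  have h1 : (N : ℝ) = √(2 * π) / 2 * b * rexp (b ^ 2 / 2) := by
    have := h.2
    linarith
  have h0 := sqrt_two_pi_ge_one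
  have h2 : rexp (-(b + s / b) ^ 2 / 2) = rexp (-s - s ^ 2 / (2 * b ^ 2)) * (rexp (b ^ 2 / 2))⁻¹ := by
    rw [← Real.exp_neg, ← Real.exp_add]
    congr 1
    field_simp
    ring
  rw [psi, h1, h2]
  field_simp

def FF (k N : ℕ) (s : ℝ) : ℝ :=
  (Set.Ioi (-(bN N) ^ 2)).indicator
    (fun s => rexp (-(k * s) - k * s ^ 2 / (2 * bN N ^ 2)) * QQ (bN N + s / bN N) ^ N) s

lemma FF_meas (k N : ℕ) : Measurable (FF k N) := by
  refine Measurable.indicator ?_ measurableSet_Ioi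
  have := QQ_mono.measurable
  fun_prop

def CC (k : ℕ) : ℝ := 1 + (2 * k + 2).factorial / (rexp (-(3/2)) / 2) ^ (2 * k + 2)

lemma CC_ge (k : ℕ) : 1 ≤ CC k := by
  unfold CC
  have : (0:ℝ) ≤ (2 * k + 2).factorial / (rexp (-(3/2)) / 2) ^ (2 * k + 2) := by positivity
  linarith

lemma FF_bound {k N : ℕ} (hk : 1 ≤ k) (hb : 1 ≤ bN N) (s : ℝ) :
    ‖FF k N s‖ ≤ CC k * rexp (-|s|) := by
  have hC := CC_ge k
  have hk' : (1:ℝ) ≤ k := by exact_mod_cast hk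
  unfold FF
  rw [Set.indicator_apply]
  split_ifs with hs
  swap
  · simp only [norm_zero]; positivity
  have hQ0 := QQ_nonneg (bN N + s / bN N)
  have hQ1 := QQ_le_one (bN N + s / bN N)
  have hbs := bN_spec N
  have hs : -(bN N) ^ 2 < s := hs
  generalize bN N = b at *
  have hb0 : 0 < b := by linarith
  rw [Real.norm_eq_abs, abs_of_nonneg (by positivity)]
  rcases le_or_gt 0 s with h0 | h0
  · rw [abs_of_nonneg h0]
    have h1 : rexp (-(k * s) - k * s ^ 2 / (2 * b ^ 2)) ≤ rexp (-s) := by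
      apply Real.exp_le_exp.2
      have : 0 ≤ k * s ^ 2 / (2 * b ^ 2) := by positivity
      nlinarith
    have h2 : QQ (b + s / b) ^ N ≤ 1 := pow_le_one₀ hQ0 hQ1
    calc _ ≤ rexp (-s) * 1 := by gcongr
      _ = 1 * rexp (-s) := by ring
      _ ≤ _ := by gcongr
  · rw [abs_of_neg h0]
    have ht0 : 0 ≤ b + s / b := by
      have : b + s / b = (b ^ 2 + s) / b := by field_simp
      rw [this]
      apply div_nonneg _ hb0.le
      linarith
    have htb : b + s / b ≤ b := by
      have : s / b ≤ 0 := div_nonpos_of_nonpos_of_nonneg h0.le hb0.le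
      linarith
    set a : ℝ := rexp (-(3/2)) / 2 with ha
    have ha0 : 0 < a := by positivity
    set y : ℝ := rexp (-s / 2) with hy
    have hy0 : 0 < y := exp_pos _
    have h1 : a * y ≤ N * psi (b + s / b) := by
      rw [Npsi hbs hb0]
      have h2 : y ≤ rexp (-s - s ^ 2 / (2 * b ^ 2)) := by
        apply Real.exp_le_exp.2
        have : s ^ 2 / (2 * b ^ 2) ≤ -s / 2 := by
          rw [div_le_div_iff₀ (by positivity) (by norm_num)]
          nlinarith
        linarith
      have h3 : a / b ≤ MM (b + s / b) := by
        refine le_trans ?_ (MM_lower ht0)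
        rw [ha, div_div]
        gcongr
        linarith
      calc a * y = b * y * (a / b) := by field_simp
        _ ≤ _ := by gcongr
    have h2 : QQ (b + s / b) ^ N ≤ rexp (-(a * y)) := by
      calc QQ (b + s / b) ^ N ≤ rexp (-psi (b + s / b)) ^ N := by
            apply pow_le_pow_left₀ hQ0
            rw [QQ_eq ht0]
            have := Real.add_one_le_exp (-psi (b + s / b))
            linarith
        _ = rexp (-(N * psi (b + s / b))) := by
            rw [← Real.exp_nat_mul]
            congr 1
            ring
        _ ≤ _ := by
            apply Real.exp_le_exp.2
            linarith
    have h3 : rexp (-(k * s) - k * s ^ 2 / (2 * b ^ 2)) ≤ y ^ (2 * k) := by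
      rw [hy, ← Real.exp_nat_mul]
      apply Real.exp_le_exp.2
      have : 0 ≤ k * s ^ 2 / (2 * b ^ 2) := by positivity
      push_cast
      linarith
    have h4 := Real.pow_div_factorial_le_exp (a * y) (by positivity) (2 * k + 2)
    have h5 : rexp (- -s) = (y ^ 2)⁻¹ := by
      rw [hy, ← Real.exp_nat_mul, ← Real.exp_neg]
      congr 1
      push_cast
      ring
    have hf : (0:ℝ) < (2 * k + 2).factorial := by exact_mod_cast Nat.factorial_pos _
    calc _ ≤ y ^ (2 * k) * rexp (-(a * y)) := by gcongr
      _ ≤ y ^ (2 * k) * ((a * y) ^ (2 * k + 2) / (2 * k + 2).factorial)⁻¹ := by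
          rw [Real.exp_neg]
          gcongr
      _ = (2 * k + 2).factorial / a ^ (2 * k + 2) * (y ^ 2)⁻¹ := by
          rw [mul_pow, pow_add y]
          field_simp
      _ ≤ _ := by
          rw [h5, CC]
          gcongr
          linarith

lemma FF_lim {k : ℕ} (s : ℝ) :
    Tendsto (fun N => FF k N s) atTop (nhds (rexp (-(k * s)) * rexp (-rexp (-s)))) := by
  have hbt := bN_tendsto
  have hb2 : Tendsto (fun N => 2 * bN N ^ 2) atTop atTop :=
    ((tendsto_pow_atTop two_ne_zero).comp hbt).const_mul_atTop two_pos
  have hsb : Tendsto (fun N => s / bN N) atTop (nhds 0) := Tendsto.div_atTop tendsto_const_nhds hbt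
  have htt : Tendsto (fun N => bN N + s / bN N) atTop atTop := hbt.atTop_add hsb
  have h1 : Tendsto (fun N => rexp (-(k * s) - k * s ^ 2 / (2 * bN N ^ 2))) atTop
      (nhds (rexp (-(k * s)))) := by
    refine (Real.continuous_exp.tendsto _).comp ?_
    have : Tendsto (fun N => k * s ^ 2 / (2 * bN N ^ 2)) atTop (nhds 0) :=
      Tendsto.div_atTop tendsto_const_nhds hb2
    simpa using this.const_sub (-(k * s))
  have h2 : Tendsto (fun N => rexp (-s - s ^ 2 / (2 * bN N ^ 2))) atTop
      (nhds (rexp (-s))) := by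
    refine (Real.continuous_exp.tendsto _).comp ?_
    have : Tendsto (fun N => s ^ 2 / (2 * bN N ^ 2)) atTop (nhds 0) :=
      Tendsto.div_atTop tendsto_const_nhds hb2
    simpa using this.const_sub (-s)
  have h3 : Tendsto (fun N => bN N * MM (bN N + s / bN N)) atTop (nhds 1) := by
    have hr : Tendsto (fun N => (1 + s / bN N * (bN N)⁻¹)⁻¹) atTop (nhds 1) := by
      have := ((hsb.mul (tendsto_inv_atTop_zero.comp hbt)).const_add 1).inv₀ (by simp)
      simpa using this
    have := (MM_tendsto.comp htt).mul hr
    rw [mul_one] at this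
    refine this.congr' ?_
    filter_upwards [hbt.eventually_gt_atTop 0, htt.eventually_gt_atTop 0] with N hN hN2
    simp only [Function.comp]
    have : (1 + s / bN N * (bN N)⁻¹) = (bN N + s / bN N) / bN N := by field_simp
    rw [this, inv_div]
    generalize bN N + s / bN N = t at *
    field_simp
  have h4 : Tendsto (fun N : ℕ => (N : ℝ) * (-psi (bN N + s / bN N))) atTop
      (nhds (-rexp (-s))) := by
    have := (h2.mul h3).neg
    rw [mul_one] at this
    refine this.congr' ?_
    filter_upwards [hbt.eventually_gt_atTop 0] with N hN
    rw [mul_neg, Npsi (bN_spec N) hN]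
    ring
  have h5 := h1.mul (Real.tendsto_one_add_pow_exp_of_tendsto h4)
  refine h5.congr' ?_
  have hb3 : Tendsto (fun N => bN N ^ 2) atTop atTop :=
    ((tendsto_pow_atTop two_ne_zero).comp hbt)
  filter_upwards [htt.eventually_gt_atTop 0, hb3.eventually_gt_atTop (-s)] with N hN hN2
  rw [FF, Set.indicator_of_mem (show s ∈ Set.Ioi _ from by simp only [Set.mem_Ioi]; linarith),
    QQ_eq hN.le]
  ring

lemma integrable_exp_neg_abs : Integrable (fun s : ℝ => rexp (-|s|)) := by
  rw [← integrableOn_univ, ← Set.Iic_union_Ioi (a := (0:ℝ))]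
  refine IntegrableOn.union ?_ ?_
  · refine (integrableOn_exp_Iic 0).congr_fun (fun x hx => ?_) measurableSet_Iic
    simp [abs_of_nonpos (show x ≤ 0 from hx)]
  · refine (integrableOn_exp_neg_Ioi 0).congr_fun (fun x hx => ?_) measurableSet_Ioi
    simp [abs_of_pos (show 0 < x from hx)]

lemma gumbel_integral {k : ℕ} (hk : 1 ≤ k) :
    ∫ s : ℝ, rexp (-(k * s)) * rexp (-rexp (-s)) = (k - 1).factorial := by
  have h1 := integral_image_eq_integral_abs_deriv_smul (s := Set.univ)
    (f := fun s : ℝ => rexp (-s)) (f' := fun s => -rexp (-s)) MeasurableSet.univ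
    (fun x _ => by
      have := ((hasDerivAt_id x).neg.exp).hasDerivWithinAt (s := Set.univ)
      simpa using this)
    (fun x _ y _ h => by simpa using h) (fun x : ℝ => x ^ (k - 1) * rexp (-x))
  have h2 : (fun s : ℝ => rexp (-s)) '' Set.univ = Set.Ioi 0 := by
    ext x
    constructor
    · rintro ⟨s, -, rfl⟩
      exact exp_pos _
    · intro hx
      exact ⟨-Real.log x, trivial, by simp [Real.exp_log (show 0 < x from hx)]⟩
  rw [h2, setIntegral_univ] at h1
  have h3 : ((k - 1).factorial : ℝ) = ∫ x in Set.Ioi (0:ℝ), x ^ (k - 1) * rexp (-x) := by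
    rw [← Real.Gamma_nat_eq_factorial, Real.Gamma_eq_integral (by positivity)]
    refine setIntegral_congr_fun measurableSet_Ioi fun x hx => ?_
    simp only [add_sub_cancel_right, Real.rpow_natCast]
    ring
  rw [h3, h1]
  congr 1
  ext s
  rw [abs_neg, abs_of_pos (exp_pos _), smul_eq_mul, ← mul_assoc, ← pow_succ',
    Nat.sub_add_cancel hk, ← Real.exp_nat_mul]
  congr 2
  ring

lemma DD_tendsto {k : ℕ} (hk : 1 ≤ k) :
    Tendsto (fun N => ∫ s, FF k N s) atTop (nhds ((k - 1).factorial : ℝ)) := by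
  rw [← gumbel_integral hk]
  refine tendsto_integral_filter_of_dominated_convergence (fun s => CC k * rexp (-|s|)) ?_ ?_
    (integrable_exp_neg_abs.const_mul _) ?_
  · exact Eventually.of_forall fun N => (FF_meas k N).aestronglyMeasurable
  · filter_upwards [bN_tendsto.eventually_ge_atTop 1] with N hN
    exact ae_of_all _ fun s => FF_bound hk hN s
  · exact ae_of_all _ fun s => FF_lim s

lemma II_eq1 {k N : ℕ} (hk : 1 ≤ k) :
    (∫⁻ x, gG (√k) |x| ^ N ∂(gaussianReal 0 1)).toReal =
      2 * ∫ x in Set.Ioi (0:ℝ), (√(2 * π))⁻¹ * rexp (-x ^ 2 / 2) * QQ (x / √k) ^ N := by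
  have hc : 0 < √(k:ℝ) := Real.sqrt_pos.2 (by exact_mod_cast hk)
  have hm : Measurable (fun x : ℝ => gG (√k) |x| ^ N) :=
    ((gG_mono _).measurable.comp measurable_abs).pow_const N
  rw [← integral_toReal hm.aemeasurable
    (ae_of_all _ fun x => ENNReal.pow_lt_top (gG_ne_top _ _).lt_top),
    integral_gaussianReal_eq_integral_smul one_ne_zero]
  rw [← integral_comp_abs (f := fun x => (√(2 * π))⁻¹ * rexp (-x ^ 2 / 2) * QQ (x / √k) ^ N)]
  congr 1
  ext x
  simp only [gaussianPDFReal_def, sub_zero, NNReal.coe_one, mul_one, sq_abs, smul_eq_mul,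
    ENNReal.toReal_pow, gG_scale hc, QQ]

lemma II_eq {k N : ℕ} (hk : 1 ≤ k) (hN : 1 ≤ N) (hb : 0 < bN N) :
    (∫⁻ x, gG (√k) |x| ^ N ∂(gaussianReal 0 1)).toReal =
      2 * (√k / bN N) * (√(2 * π))⁻¹ * (√(2 * π) * bN N / (2 * N)) ^ k * ∫ s, FF k N s := by
  have hc : 0 < √(k:ℝ) := Real.sqrt_pos.2 (by exact_mod_cast hk)
  have hcs : √(k:ℝ) ^ 2 = k := Real.sq_sqrt (by positivity)
  rw [II_eq1 hk]
  have hspec := (bN_spec N).2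
  have hF : ∫ s, FF k N s = ∫ s in Set.Ioi (-(bN N) ^ 2),
      rexp (-(k * s) - k * s ^ 2 / (2 * bN N ^ 2)) * QQ (bN N + s / bN N) ^ N := by
    rw [← integral_indicator measurableSet_Ioi]
    rfl
  rw [hF]
  generalize bN N = b at *
  have hN' : (0:ℝ) < N := by exact_mod_cast hN
  have h2p := sqrt_two_pi_ge_one
  have hexp : √(2 * π) * b / (2 * N) = rexp (-b ^ 2 / 2) := by
    rw [← hspec, neg_div, Real.exp_neg]
    field_simp
  rw [hexp]
  have hcb : 0 < √(k:ℝ) / b := by positivity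
  have h1 := integral_comp_mul_left_Ioi'
    (fun x : ℝ => (√(2 * π))⁻¹ * rexp (-x ^ 2 / 2) * QQ (x / √k) ^ N) 0 hcb
  rw [mul_zero] at h1
  rw [← h1]
  have h2 : ∀ g : ℝ → ℝ, ∫ s in Set.Ioi (-b ^ 2), g (s + b ^ 2) = ∫ u in Set.Ioi (0:ℝ), g u := by
    intro g
    rw [← integral_indicator measurableSet_Ioi, ← integral_indicator measurableSet_Ioi,
      ← integral_add_right_eq_self ((Set.Ioi (0:ℝ)).indicator fun u => g u) (b ^ 2)]
    congr 1
    ext s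
    have : s ∈ Set.Ioi (-b ^ 2) ↔ s + b ^ 2 ∈ Set.Ioi (0:ℝ) := by
      simp only [Set.mem_Ioi]
      constructor <;> intro h <;> linarith
    simp only [Set.indicator_apply, this]
  rw [← h2, smul_eq_mul]
  have h3 : ∀ s : ℝ, (√(2 * π))⁻¹ * rexp (-(√k / b * (s + b ^ 2)) ^ 2 / 2) *
      QQ (√k / b * (s + b ^ 2) / √k) ^ N = ((√(2 * π))⁻¹ * rexp (-b ^ 2 / 2) ^ k) *
      (rexp (-(k * s) - k * s ^ 2 / (2 * b ^ 2)) * QQ (b + s / b) ^ N) := by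
    intro s
    have h4 : √k / b * (s + b ^ 2) / √k = b + s / b := by
      field_simp
      ring
    have h5 : rexp (-(√k / b * (s + b ^ 2)) ^ 2 / 2) =
        rexp (-b ^ 2 / 2) ^ k * rexp (-(k * s) - k * s ^ 2 / (2 * b ^ 2)) := by
      rw [← Real.exp_nat_mul, ← Real.exp_add, mul_pow, div_pow, hcs]
      congr 1
      field_simp
      ring
    rw [h4, h5]
    ring
  simp only [h3]
  rw [integral_const_mul]
  ring

lemma log_ratio (k : ℕ) :
    Tendsto (fun N : ℕ => (bN N ^ 2 / 2) / Real.log ((N + k : ℕ) : ℝ)) atTop (nhds 1) := by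
  have hb3 : Tendsto (fun N => bN N ^ 2 / 2) atTop atTop :=
    (((tendsto_pow_atTop two_ne_zero).comp bN_tendsto)).atTop_div_const two_pos
  have h1 : Tendsto (fun N : ℕ => Real.log (1 + k / (N:ℝ))) atTop (nhds 0) := by
    have h : Tendsto (fun N : ℕ => 1 + k / (N:ℝ)) atTop (nhds 1) := by
      simpa using (tendsto_const_div_atTop_nhds_zero_nat (k:ℝ)).const_add 1
    have := (Real.continuousAt_log one_ne_zero).tendsto.comp h
    rw [Real.log_one] at this
    exact this
  have h2 : Tendsto (fun N : ℕ => Real.log ((N + k : ℕ) : ℝ) / (bN N ^ 2 / 2)) atTop (nhds 1) := by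
    have := log_div_b.add (h1.div_atTop hb3)
    rw [add_zero] at this
    refine this.congr' ?_
    filter_upwards [eventually_gt_atTop 0] with N hN
    have hN' : (0:ℝ) < N := by exact_mod_cast hN
    rw [← add_div, ← Real.log_mul hN'.ne' (by positivity)]
    congr 2
    push_cast
    field_simp
  have := h2.inv₀ one_ne_zero
  rw [inv_one] at this
  refine this.congr fun N => ?_
  rw [inv_div]

lemma choose_ratio (k : ℕ) :
    Tendsto (fun n : ℕ => (n.choose k : ℝ) / (n ^ k / k.factorial)) atTop (nhds 1) := by
  refine (Asymptotics.isEquivalent_iff_tendsto_one ?_).1 (isEquivalent_choose k)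
  filter_upwards [eventually_gt_atTop 0] with n hn
  have : (0:ℝ) < n := by exact_mod_cast hn
  positivity

lemma final_algebra {k N : ℕ} (hk : 1 ≤ k) {b D ch L : ℝ} (hb : 0 < b) (hL : 0 < L) (hN : 1 ≤ N) :
    ch / (((N + k : ℕ) : ℝ) ^ k / k.factorial) * (1 + k / (N:ℝ)) ^ k * (D / (k - 1).factorial) *
      ((b ^ 2 / 2) / L) ^ (((k : ℝ) - 1) / 2) =
    2 ^ k * ch * (2 * (√k / b) * (√(2 * π))⁻¹ * (√(2 * π) * b / (2 * N)) ^ k * D) /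
      ((2 ^ k / √k) * (π * L) ^ (((k : ℝ) - 1) / 2)) := by
  obtain ⟨m, rfl⟩ : ∃ m, k = m + 1 := ⟨k - 1, by omega⟩
  have hN' : (0:ℝ) < N := by exact_mod_cast hN
  have h2p := sqrt_two_pi_ge_one
  have hpi := Real.pi_pos
  have hsq : √((m + 1 : ℕ) : ℝ) ^ 2 = (m + 1 : ℕ) := Real.sq_sqrt (by positivity)
  have hs0 : 0 < √((m + 1 : ℕ) : ℝ) := Real.sqrt_pos.2 (by positivity)
  set c := √((m + 1 : ℕ) : ℝ) with hc
  have hE : ((b ^ 2 / 2) / L) ^ ((((m + 1 : ℕ) : ℝ) - 1) / 2) =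
      (√(2 * π) * b / 2) ^ m / (π * L) ^ ((((m + 1 : ℕ) : ℝ) - 1) / 2) := by
    have e1 : (b ^ 2 / 2) / L = (√(2 * π) * b / 2) ^ 2 / (π * L) := by
      rw [div_pow, mul_pow, Real.sq_sqrt (by positivity)]
      field_simp
    rw [e1, Real.div_rpow (by positivity) (by positivity)]
    congr 1
    rw [← Real.rpow_natCast _ 2, ← Real.rpow_mul (by positivity), ← Real.rpow_natCast _ m]
    congr 1
    push_cast
    ring
  have hn : 1 + ((m + 1 : ℕ) : ℝ) / (N:ℝ) = ((N + (m + 1) : ℕ) : ℝ) / N := by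
    push_cast
    field_simp
  have hP : 0 < (π * L) ^ ((((m + 1 : ℕ) : ℝ) - 1) / 2) := by positivity
  have hnp : 0 < ((N + (m + 1) : ℕ) : ℝ) := by positivity
  have hf : ((m + 1).factorial : ℝ) = c ^ 2 * m.factorial := by
    rw [hsq, Nat.factorial_succ]
    push_cast
    ring
  have hf0 : (0:ℝ) < m.factorial := by exact_mod_cast Nat.factorial_pos _
  rw [hE, hn, hf, Nat.add_sub_cancel]
  generalize (π * L) ^ ((((m + 1 : ℕ) : ℝ) - 1) / 2) = P at *
  generalize ((N + (m + 1) : ℕ) : ℝ) = M at *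
  generalize √(2 * π) = r at *
  have hr : 0 < r := by linarith
  simp only [div_pow, mul_pow, pow_succ]
  field_simp

/-- for fixed `k ≥ 1`, `f(0,k,n) ∼ (2^k/√k)(π log n)^{(k-1)/2}` as `n → ∞`. -/
theorem expected_vertices_asymptotics (k : ℕ) (hk : 1 ≤ k)
    (H : ∀ n, Measure (OG n))
    (hHaar : ∀ n, (H n).IsHaarMeasure) (hProb : ∀ n, IsProbabilityMeasure (H n)) :
    Tendsto (fun n : ℕ =>
        expFaces n (H n) 0 k /
          ((2 ^ k / Real.sqrt k) * (π * Real.log n) ^ (((k : ℝ) - 1) / 2)))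
      atTop (nhds 1) := by
  rw [← tendsto_add_atTop_iff_nat k]
  have hA := (choose_ratio k).comp (tendsto_add_atTop_nat k)
  have hB : Tendsto (fun N : ℕ => (1 + k / (N:ℝ)) ^ k) atTop (nhds 1) := by
    have h : Tendsto (fun N : ℕ => 1 + k / (N:ℝ)) atTop (nhds 1) := by
      simpa using (tendsto_const_div_atTop_nhds_zero_nat (k:ℝ)).const_add 1
    simpa using h.pow k
  have hD := (DD_tendsto hk).div_const ((k - 1).factorial : ℝ)
  rw [div_self (by positivity)] at hD
  have hE : Tendsto (fun N : ℕ => ((bN N ^ 2 / 2) / Real.log ((N + k : ℕ) : ℝ)) ^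
      (((k : ℝ) - 1) / 2)) atTop (nhds 1) := by
    have := (log_ratio k).rpow_const (p := ((k : ℝ) - 1) / 2) (Or.inl one_ne_zero)
    simpa using this
  have hall := ((hA.mul hB).mul hD).mul hE
  simp only [mul_one] at hall
  refine hall.congr' ?_
  filter_upwards [eventually_ge_atTop 2, bN_tendsto.eventually_gt_atTop 0] with N hN hb
  have := hHaar (N + k)
  have := hProb (N + k)
  have hL : 0 < Real.log ((N + k : ℕ) : ℝ) := Real.log_pos (by
    have : 1 < N + k := by omega
    exact_mod_cast this)
  rw [expFaces, haar_prob hk (Nat.le_add_left k N) (H (N + k)), Nat.add_sub_cancel,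
    II_eq hk (by omega) hb, Nat.sub_zero]
  exact final_algebra hk hb hL (by omega)
end
end

section
/- Let d ≥ 1 and n > d be integers. Then f(0,n−d,n) ≥ binom(n,d) · 2^n · ((1/π) · arctan(1/√(n−d)))^d. -/
open MeasureTheory Filter Real

noncomputable section

lemma aux_radial : ∫⁻ r in Set.Ioi (0:ℝ), ENNReal.ofReal (r * rexp (-(r^2)/2)) = 1 := by
  have hint : Integrable (fun r : ℝ => r * rexp (-(r^2)/2)) := by
    have := integrable_mul_exp_neg_mul_sq (b := 1/2) (by norm_num)
    refine this.congr (Filter.Eventually.of_forall fun x => ?_)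
    simp only; congr 2; ring
  rw [← ofReal_integral_eq_lintegral_ofReal hint.integrableOn]
  · have := integral_Ioi_of_hasDerivAt_of_tendsto (a := (0:ℝ)) (m := (0:ℝ))
      (f := fun r : ℝ => -rexp (-(r^2)/2)) (f' := fun r : ℝ => r * rexp (-(r^2)/2))
      (by fun_prop) (fun x _ => by
        have h1 : HasDerivAt (fun r : ℝ => -(r^2)/2) (-x) x := by
          have := ((hasDerivAt_pow 2 x).neg).div_const 2
          convert! this using 1; simp; ring
        convert! h1.exp.neg using 1; ring) hint.integrableOn (by
        rw [← neg_zero]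
        refine Tendsto.neg (Real.tendsto_exp_atBot.comp ?_)
        have : Tendsto (fun r : ℝ => (r^2)/2) atTop atTop :=
          (tendsto_pow_atTop (by norm_num)).atTop_div_const (by norm_num)
        have h2 := tendsto_neg_atTop_atBot.comp this
        refine h2.congr fun x => ?_
        simp [neg_div])
    rw [this]; simp
  · filter_upwards [self_mem_ae_restrict measurableSet_Ioi] with r hr
    have : (0:ℝ) < r := hr
    positivity

lemma aux_angle {s : ℝ} (hs : 0 < s) {t : ℝ} (ht : |t| < arctan (1/s)) :
    0 < cos t ∧ s * |sin t| ≤ |cos t| := by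
  have h1 := arctan_lt_pi_div_two (1/s)
  have h2 := abs_lt.1 ht
  have hc : 0 < cos t := cos_pos_of_mem_Ioo ⟨by linarith, by linarith⟩
  refine ⟨hc, ?_⟩
  have h3 : |tan t| ≤ 1/s := by
    have ha : arctan (tan t) = t := arctan_tan (by linarith) (by linarith)
    rw [abs_le]
    constructor
    · apply le_of_lt; rw [← arctan_strictMono.lt_iff_lt, arctan_neg, ha]; exact h2.1
    · apply le_of_lt; rw [← arctan_strictMono.lt_iff_lt, ha]; exact h2.2
  rw [tan_eq_sin_div_cos, abs_div, div_le_div_iff₀ (abs_pos.2 hc.ne') hs] at h3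
  linarith

lemma aux_angle_vol {s : ℝ} (hs : 0 < s) :
    ENNReal.ofReal (4 * arctan (1/s)) ≤
      volume {t : ℝ | t ∈ Set.Ioo (-π) π ∧ cos t ≠ 0 ∧ s * |sin t| ≤ |cos t|} := by
  set a := arctan (1/s) with ha
  have ha0 : 0 < a := arctan_pos.2 (by positivity)
  have ha1 : a < π/2 := arctan_lt_pi_div_two _
  have hsub : (Set.Ioo (-a) a ∪ Set.Ioo (π - a) π) ∪ Set.Ioo (-π) (-π + a) ⊆
      {t : ℝ | t ∈ Set.Ioo (-π) π ∧ cos t ≠ 0 ∧ s * |sin t| ≤ |cos t|} := by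
    rintro t ((⟨h1, h2⟩ | ⟨h1, h2⟩) | ⟨h1, h2⟩)
    · have := aux_angle hs (t := t) (abs_lt.2 ⟨h1, h2⟩)
      exact ⟨⟨by linarith, by linarith⟩, this.1.ne', this.2⟩
    · have := aux_angle hs (t := t - π) (abs_lt.2 ⟨by linarith, by linarith⟩)
      rw [cos_sub_pi, sin_sub_pi, abs_neg, abs_neg] at this
      exact ⟨⟨by linarith, by linarith⟩, by intro h; linarith [this.1], this.2⟩
    · have := aux_angle hs (t := t + π) (abs_lt.2 ⟨by linarith, by linarith⟩)
      rw [cos_add_pi, sin_add_pi, abs_neg, abs_neg] at this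
      exact ⟨⟨by linarith, by linarith⟩, by intro h; linarith [this.1], this.2⟩
  refine le_trans ?_ (measure_mono hsub)
  rw [measure_union _ measurableSet_Ioo, measure_union _ measurableSet_Ioo]
  · simp only [Real.volume_Ioo]
    rw [← ENNReal.ofReal_add (by linarith) (by linarith), ← ENNReal.ofReal_add (by linarith) (by linarith)]
    apply ENNReal.ofReal_le_ofReal; linarith
  · rw [Set.disjoint_left]; rintro t ⟨h1, h2⟩ ⟨h3, h4⟩; linarith
  · rw [Set.disjoint_left]; rintro t (⟨h1, h2⟩ | ⟨h1, h2⟩) ⟨h3, h4⟩ <;> linarith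

lemma aux_two_gauss {s : ℝ} (hs : 0 < s) :
    ENNReal.ofReal (2 / π * arctan (1/s)) ≤
      ((ProbabilityTheory.gaussianReal 0 1).prod (ProbabilityTheory.gaussianReal 0 1))
        {p : ℝ × ℝ | p.1 ≠ 0 ∧ s * |p.2| ≤ |p.1|} := by
  set S : Set (ℝ × ℝ) := {p : ℝ × ℝ | p.1 ≠ 0 ∧ s * |p.2| ≤ |p.1|} with hS
  have hSm : MeasurableSet S := by
    have e : S = {p : ℝ × ℝ | p.1 ≠ 0} ∩ {p : ℝ × ℝ | s * |p.2| ≤ |p.1|} := by ext; simp [hS]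
    rw [e]
    refine MeasurableSet.inter ?_ ?_
    · exact (measurableSet_eq_fun measurable_fst measurable_const).compl
    · exact measurableSet_le (by fun_prop) (by fun_prop)
  set A : Set ℝ := {t : ℝ | t ∈ Set.Ioo (-π) π ∧ cos t ≠ 0 ∧ s * |sin t| ≤ |cos t|} with hA
  have hAm : MeasurableSet A := by
    have e : A = Set.Ioo (-π) π ∩ ({t : ℝ | cos t ≠ 0} ∩ {t : ℝ | s * |sin t| ≤ |cos t|}) := by
      ext; simp [hA]
    rw [e]
    refine MeasurableSet.inter measurableSet_Ioo (MeasurableSet.inter ?_ ?_)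
    · exact (measurableSet_eq_fun (by fun_prop) measurable_const).compl
    · exact measurableSet_le (by fun_prop) (by fun_prop)
  have h1 : ((ProbabilityTheory.gaussianReal 0 1).prod (ProbabilityTheory.gaussianReal 0 1)) S
      = ∫⁻ p : ℝ × ℝ, S.indicator (fun p => ProbabilityTheory.gaussianPDF 0 1 p.1 *
          ProbabilityTheory.gaussianPDF 0 1 p.2) p := by
    rw [ProbabilityTheory.gaussianReal_of_var_ne_zero _ one_ne_zero,
      prod_withDensity (by fun_prop) (by fun_prop), withDensity_apply _ hSm,
      lintegral_indicator hSm]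
    rfl
  rw [h1, ← lintegral_comp_polarCoord_symm]
  have hsub : Set.Ioi (0:ℝ) ×ˢ A ⊆ polarCoord.target := by
    rintro ⟨r, t⟩ ⟨hr, ht⟩
    exact ⟨hr, ht.1⟩
  refine le_trans ?_ (lintegral_mono_set hsub)
  have h2 : ∀ p ∈ Set.Ioi (0:ℝ) ×ˢ A, ENNReal.ofReal p.1 • S.indicator (fun p => ProbabilityTheory.gaussianPDF 0 1 p.1 *
          ProbabilityTheory.gaussianPDF 0 1 p.2) (polarCoord.symm p) =
      ENNReal.ofReal (p.1 * rexp (-(p.1^2)/2)) * ENNReal.ofReal (1/(2*π)) := by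
    rintro ⟨r, t⟩ ⟨hr, ht⟩
    have hr : (0:ℝ) < r := hr
    have hmem : polarCoord.symm (r, t) ∈ S := by
      simp only [polarCoord_symm_apply, hS, Set.mem_ofPred_eq]
      refine ⟨mul_ne_zero hr.ne' ht.2.1, ?_⟩
      rw [abs_mul, abs_mul, abs_of_pos hr]
      nlinarith [ht.2.2]
    rw [Set.indicator_of_mem hmem]
    simp only [polarCoord_symm_apply, ProbabilityTheory.gaussianPDF, ProbabilityTheory.gaussianPDFReal, smul_eq_mul]
    rw [← ENNReal.ofReal_mul (by positivity), ← ENNReal.ofReal_mul (by positivity), ← ENNReal.ofReal_mul (by positivity)]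
    congr 1
    have e1 : rexp (-(r^2)/2) = rexp (-(r * cos t - 0) ^ 2 / (2 * ((1:NNReal):ℝ))) * rexp (-(r * sin t - 0) ^ 2 / (2 * ((1:NNReal):ℝ))) := by
      rw [← Real.exp_add]; congr 1
      simp only [NNReal.coe_one, sub_zero]
      linear_combination (r^2/2) * (sin_sq_add_cos_sq t)
    have e2 : (√(2 * π * ((1:NNReal):ℝ)))⁻¹ * (√(2 * π * ((1:NNReal):ℝ)))⁻¹ = 1/(2*π) := by
      rw [← mul_inv, Real.mul_self_sqrt (by positivity)]; simp
    rw [e1, ← e2]; ring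
  rw [setLIntegral_congr_fun (measurableSet_Ioi.prod hAm) h2, Measure.volume_eq_prod, ← Measure.prod_restrict,
    lintegral_prod_mul (f := fun r : ℝ => ENNReal.ofReal (r * rexp (-(r^2)/2))) (g := fun _ => ENNReal.ofReal (1/(2*π))) (by fun_prop) (by fun_prop), aux_radial, one_mul,
    lintegral_const, Measure.restrict_apply_univ]
  refine le_trans (le_of_eq ?_) (mul_le_mul_right (aux_angle_vol hs) _)
  rw [← ENNReal.ofReal_mul (by positivity)]
  congr 1; field_simp; ring

def cone (d : ℕ) (s : ℝ) : Set (Fin (d+1) → ℝ) := {z | z 0 ≠ 0 ∧ ∀ j : Fin d, s * |z j.succ| ≤ |z 0|}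

lemma measurableSet_cone (d : ℕ) (s : ℝ) : MeasurableSet (cone d s) := by
  have : cone d s = {z | z 0 ≠ 0} ∩ ⋂ j : Fin d, {z | s * |z j.succ| ≤ |z 0|} := by
    ext z; simp [cone]
  rw [this]
  refine MeasurableSet.inter ?_ (MeasurableSet.iInter fun j => ?_)
  · exact (measurableSet_eq_fun (by fun_prop) measurable_const).compl
  · exact measurableSet_le (by fun_prop) (by fun_prop)

lemma aux_cone {d : ℕ} (hd : 1 ≤ d) {s : ℝ} (hs : 0 < s) :
    ENNReal.ofReal (2 / π * arctan (1/s)) ^ d ≤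
      (Measure.pi fun _ : Fin (d+1) => ProbabilityTheory.gaussianReal 0 1) (cone d s) := by
  set γ := ProbabilityTheory.gaussianReal 0 1 with hγ
  set S : Set (ℝ × ℝ) := {p : ℝ × ℝ | p.1 ≠ 0 ∧ s * |p.2| ≤ |p.1|} with hS
  have hSm : MeasurableSet S := by
    have e : S = {p : ℝ × ℝ | p.1 ≠ 0} ∩ {p : ℝ × ℝ | s * |p.2| ≤ |p.1|} := by ext; simp [hS]
    rw [e]
    refine MeasurableSet.inter ?_ ?_
    · exact (measurableSet_eq_fun measurable_fst measurable_const).compl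
    · exact measurableSet_le (by fun_prop) (by fun_prop)
  let f : ℝ → ENNReal := fun t => γ (Prod.mk t ⁻¹' S)
  have hf : Measurable f := measurable_measure_prodMk_left hSm
  have h1 : (Measure.pi fun _ : Fin (d+1) => γ) (cone d s) = ∫⁻ t, f t ^ d ∂γ := by
    have hmp := measurePreserving_piFinSuccAbove (fun _ : Fin (d+1) => γ) 0
    let T : Set (ℝ × (Fin d → ℝ)) := {p | p.1 ≠ 0 ∧ ∀ j, s * |p.2 j| ≤ |p.1|}
    have hT : cone d s = (MeasurableEquiv.piFinSuccAbove (fun _ => ℝ) 0) ⁻¹' T := by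
      ext z
      simp [cone, T, MeasurableEquiv.piFinSuccAbove, Fin.tail]
    have hTm : MeasurableSet T := by
      have : T = {z | z.1 ≠ 0} ∩ ⋂ j : Fin d, {z | s * |z.2 j| ≤ |z.1|} := by
        ext z; simp [T]
      rw [this]
      refine MeasurableSet.inter ?_ (MeasurableSet.iInter fun j => ?_)
      · exact (measurableSet_eq_fun (by fun_prop) measurable_const).compl
      · exact measurableSet_le (by fun_prop) (by fun_prop)
    rw [hT, hmp.measure_preimage hTm.nullMeasurableSet, Measure.prod_apply hTm]
    refine lintegral_congr fun t => ?_
    have : Prod.mk t ⁻¹' T = Set.univ.pi fun _ : Fin d => Prod.mk t ⁻¹' S := by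
      ext z
      simp only [T, hS, Set.mem_preimage, Set.mem_ofPred_eq, Set.mem_univ_pi]
      exact ⟨fun h j => ⟨h.1, h.2 j⟩, fun h => ⟨(h ⟨0, hd⟩).1, fun j => (h j).2⟩⟩
    rw [this, Measure.pi_pi]
    simp [f]
  have h2 := aux_two_gauss hs
  rw [Measure.prod_apply hSm] at h2
  rw [h1]
  refine le_trans (pow_le_pow_left' h2 d) ?_
  have h3 := eLpNorm'_le_eLpNorm'_of_exponent_le (f := f) (p := 1) (q := d) one_pos (by exact_mod_cast hd) γ hf.aestronglyMeasurable
  have hd0 : (0:ℝ) < d := by exact_mod_cast hd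
  simp only [eLpNorm', enorm_eq_self, ENNReal.rpow_one, div_one, ENNReal.rpow_natCast] at h3
  calc (∫⁻ t, f t ∂γ) ^ d ≤ ((∫⁻ t, f t ^ d ∂γ) ^ (1/(d:ℝ))) ^ d := pow_le_pow_left' h3 d
    _ = _ := by rw [← ENNReal.rpow_natCast, ← ENNReal.rpow_mul, one_div_mul_cancel hd0.ne', ENNReal.rpow_one]

instance og_secondCountable (n : ℕ) : SecondCountableTopology (OG n) :=
  haveI : SecondCountableTopology (Matrix (Fin n) (Fin n) ℝ) :=
    inferInstanceAs (SecondCountableTopology (Fin n → Fin n → ℝ))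
  inferInstanceAs (SecondCountableTopology
    ((Matrix.orthogonalGroup (Fin n) ℝ : Set (Matrix (Fin n) (Fin n) ℝ))))

lemma og_mul_tr {n : ℕ} (g : OG n) : (g : Matrix (Fin n) (Fin n) ℝ) * (g : Matrix (Fin n) (Fin n) ℝ).transpose = 1 :=
  (Matrix.mem_orthogonalGroup_iff (Fin n) ℝ).1 g.2

lemma og_tr_mul {n : ℕ} (g : OG n) : (g : Matrix (Fin n) (Fin n) ℝ).transpose * (g : Matrix (Fin n) (Fin n) ℝ) = 1 :=
  (Matrix.mem_orthogonalGroup_iff' (Fin n) ℝ).1 g.2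

instance og_compact (n : ℕ) : CompactSpace (OG n) := by
  have hc : IsCompact (Matrix.orthogonalGroup (Fin n) ℝ : Set (Matrix (Fin n) (Fin n) ℝ)) := by
    have hbox : IsCompact (Set.univ.pi fun _ : Fin n => Set.univ.pi fun _ : Fin n => Set.Icc (-1:ℝ) 1) :=
      isCompact_univ_pi fun _ => isCompact_univ_pi fun _ => isCompact_Icc
    refine IsCompact.of_isClosed_subset (t := (Matrix.orthogonalGroup (Fin n) ℝ : Set (Matrix (Fin n) (Fin n) ℝ))) hbox ?_ ?_
    · have : (Matrix.orthogonalGroup (Fin n) ℝ : Set (Matrix (Fin n) (Fin n) ℝ)) =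
        {A | A * A.transpose = 1} := by
        ext A; exact Matrix.mem_orthogonalGroup_iff (Fin n) ℝ
      rw [this]
      exact isClosed_eq (by fun_prop) continuous_const
    · intro A hA i _ j _
      have := entry_norm_bound_of_unitary (𝕜 := ℝ) hA i j
      rw [Real.norm_eq_abs] at this
      exact abs_le.1 this
  exact isCompact_iff_compactSpace.1 hc

lemma gauss_invariant {m : ℕ} (g : OG m) {C : Set (Fin m → ℝ)} (hC : MeasurableSet C) :
    (Measure.pi fun _ : Fin m => ProbabilityTheory.gaussianReal 0 1)
      {z | (g : Matrix (Fin m) (Fin m) ℝ).mulVec z ∈ C} =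
    (Measure.pi fun _ : Fin m => ProbabilityTheory.gaussianReal 0 1) C := by
  let L : EuclideanSpace ℝ (Fin m) →ₗᵢ[ℝ] EuclideanSpace ℝ (Fin m) :=
    { toLinearMap := Matrix.toEuclideanLin (g : Matrix (Fin m) (Fin m) ℝ)
      norm_map' := by
        intro x
        have key : ∀ y : Fin m → ℝ, ‖WithLp.toLp 2 y‖ ^ 2 = y ⬝ᵥ y := by
          intro y
          rw [EuclideanSpace.real_norm_sq_eq]
          simp [dotProduct, pow_two]
        rw [← sq_eq_sq₀ (norm_nonneg _) (norm_nonneg _)]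
        have h1 := key (WithLp.ofLp x)
        have h2 := key ((g : Matrix (Fin m) (Fin m) ℝ).mulVec (WithLp.ofLp x))
        have e : (Matrix.toEuclideanLin (g : Matrix (Fin m) (Fin m) ℝ)) x =
          WithLp.toLp 2 ((g : Matrix (Fin m) (Fin m) ℝ).mulVec (WithLp.ofLp x)) := rfl
        rw [e, h2]
        rw [Matrix.dotProduct_mulVec, Matrix.vecMul_mulVec, og_tr_mul, Matrix.vecMul_one]
        exact h1.symm }
  let e := L.toLinearIsometryEquiv rfl
  have h := ProbabilityTheory.stdGaussian_map e
  have hC' : MeasurableSet ((WithLp.ofLp : EuclideanSpace ℝ (Fin m) → (Fin m → ℝ)) ⁻¹' C) :=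
    (by fun_prop : Measurable (WithLp.ofLp : EuclideanSpace ℝ (Fin m) → (Fin m → ℝ))) hC
  have h' := congrArg (fun μ => μ ((WithLp.ofLp : EuclideanSpace ℝ (Fin m) → (Fin m → ℝ)) ⁻¹' C)) h
  simp only at h'
  have hem : Measurable e := e.continuous.measurable
  rw [Measure.map_apply hem hC', ← ProbabilityTheory.map_pi_eq_stdGaussian,
    Measure.map_apply (by fun_prop) (hem hC'), Measure.map_apply (by fun_prop) hC'] at h'
  exact h'

lemma og_transitive {m : ℕ} (v w : Fin m → ℝ) (h : v ⬝ᵥ v = w ⬝ᵥ w) :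
    ∃ r : OG m, (r : Matrix (Fin m) (Fin m) ℝ).mulVec v = w := by
  by_cases hvw : v = w
  · exact ⟨1, by simp [hvw]⟩
  set a := v - w with ha
  have ha0 : a ⬝ᵥ a ≠ 0 := by
    intro h0
    exact hvw (sub_eq_zero.1 (dotProduct_self_eq_zero.1 h0))
  have hav : a ⬝ᵥ a = 2 * (a ⬝ᵥ v) := by
    simp only [ha, sub_dotProduct, dotProduct_sub, dotProduct_comm w v]
    linarith
  set c : ℝ := 2 / (a ⬝ᵥ a) with hc
  let R : Matrix (Fin m) (Fin m) ℝ := 1 - c • Matrix.vecMulVec a a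
  have hRt : R.transpose = R := by
    simp [R, Matrix.transpose_sub, Matrix.transpose_smul, Matrix.transpose_vecMulVec]
  have hVV : Matrix.vecMulVec a a * Matrix.vecMulVec a a = (a ⬝ᵥ a) • Matrix.vecMulVec a a := by
    ext i j
    simp only [Matrix.mul_apply, Matrix.vecMulVec_apply, Matrix.smul_apply, smul_eq_mul, dotProduct,
      Finset.sum_mul]
    exact Finset.sum_congr rfl fun _ _ => by ring
  have hRR : R * R.transpose = 1 := by
    rw [hRt]
    simp only [R, sub_mul, mul_sub, one_mul, mul_one, smul_mul_assoc, mul_smul_comm, hVV, smul_smul]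
    have : c * (a ⬝ᵥ a) = 2 := by rw [hc]; field_simp
    rw [this, two_smul, smul_sub, smul_add]; abel
  refine ⟨⟨R, (Matrix.mem_orthogonalGroup_iff (Fin m) ℝ).2 hRR⟩, ?_⟩
  have hV : (Matrix.vecMulVec a a).mulVec v = (a ⬝ᵥ v) • a := by
    ext i
    simp only [Matrix.mulVec, dotProduct, Matrix.vecMulVec_apply, Pi.smul_apply, smul_eq_mul, Finset.sum_mul]
    exact Finset.sum_congr rfl fun _ _ => by ring
  show R.mulVec v = w
  simp only [R, Matrix.sub_mulVec, Matrix.one_mulVec, Matrix.smul_mulVec, hV, smul_smul]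
  have : c * (a ⬝ᵥ v) = 1 := by
    rw [hc, hav]
    have : a ⬝ᵥ v ≠ 0 := by intro h0; exact ha0 (by rw [hav, h0]; simp)
    field_simp
  rw [this, one_smul, ha]; abel

lemma cone_smul {d : ℕ} {s : ℝ} {t : ℝ} (ht : 0 < t) (z : Fin (d+1) → ℝ) :
    t • z ∈ cone d s ↔ z ∈ cone d s := by
  have : ∀ x y : ℝ, s * (t * |x|) ≤ t * |y| ↔ s * |x| ≤ |y| := by
    intro x y
    rw [show s * (t * |x|) = t * (s * |x|) by ring]
    exact mul_le_mul_iff_right₀ ht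
  simp [cone, abs_mul, abs_of_pos ht, ht.ne', this]

/-- orbit measure of the cone -/
lemma orbit_measure {d : ℕ} (s : ℝ) (ν : Measure (OG (d+1)))
    [ν.IsMulLeftInvariant] [IsProbabilityMeasure ν] (z : Fin (d+1) → ℝ) (hz : z ≠ 0) :
    ν {h | (h : Matrix (Fin (d+1)) (Fin (d+1)) ℝ).transpose.mulVec z ∈ cone d s} =
      (Measure.pi fun _ : Fin (d+1) => ProbabilityTheory.gaussianReal 0 1) (cone d s) := by
  set γ := (Measure.pi fun _ : Fin (d+1) => ProbabilityTheory.gaussianReal 0 1) with hγ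
  have hconst : ∀ w : Fin (d+1) → ℝ, w ≠ 0 →
      ν {h | (h : Matrix (Fin (d+1)) (Fin (d+1)) ℝ).transpose.mulVec w ∈ cone d s} =
      ν {h | (h : Matrix (Fin (d+1)) (Fin (d+1)) ℝ).transpose.mulVec z ∈ cone d s} := by
    intro w hw
    have pz : 0 < z ⬝ᵥ z := lt_of_le_of_ne (by simpa using dotProduct_star_self_nonneg z)
      (fun h => hz (dotProduct_self_eq_zero.1 h.symm))
    have pw : 0 < w ⬝ᵥ w := lt_of_le_of_ne (by simpa using dotProduct_star_self_nonneg w)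
      (fun h => hw (dotProduct_self_eq_zero.1 h.symm))
    set t := √(w ⬝ᵥ w / z ⬝ᵥ z) with ht
    have ht0 : 0 < t := Real.sqrt_pos.2 (div_pos pw pz)
    obtain ⟨r, hr⟩ := og_transitive (t • z) w (by
      simp only [smul_dotProduct, dotProduct_smul, smul_eq_mul]
      rw [← mul_assoc, ht, Real.mul_self_sqrt (div_pos pw pz).le]
      field_simp)
    rw [← measure_preimage_mul ν r⁻¹
      {h | (h : Matrix (Fin (d+1)) (Fin (d+1)) ℝ).transpose.mulVec z ∈ cone d s}]
    congr 1
    ext h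
    have e : ((r⁻¹ * h : OG (d+1)) : Matrix (Fin (d+1)) (Fin (d+1)) ℝ).transpose =
        (h : Matrix (Fin (d+1)) (Fin (d+1)) ℝ).transpose * (r : Matrix (Fin (d+1)) (Fin (d+1)) ℝ) := by
      have : ((r⁻¹ * h : OG (d+1)) : Matrix (Fin (d+1)) (Fin (d+1)) ℝ) =
        (r : Matrix (Fin (d+1)) (Fin (d+1)) ℝ).transpose * (h : Matrix (Fin (d+1)) (Fin (d+1)) ℝ) := rfl
      rw [this, Matrix.transpose_mul, Matrix.transpose_transpose]
    simp only [Set.mem_preimage, Set.mem_ofPred_eq, e]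
    rw [← hr, Matrix.mulVec_smul, Matrix.mulVec_smul, cone_smul ht0, Matrix.mulVec_mulVec]
  set c := ν {h | (h : Matrix (Fin (d+1)) (Fin (d+1)) ℝ).transpose.mulVec z ∈ cone d s} with hc
  let T : Set ((Fin (d+1) → ℝ) × OG (d+1)) :=
    {p | (p.2 : Matrix (Fin (d+1)) (Fin (d+1)) ℝ).transpose.mulVec p.1 ∈ cone d s}
  have hT : MeasurableSet T := by
    have : Continuous fun p : (Fin (d+1) → ℝ) × OG (d+1) =>
      (p.2 : Matrix (Fin (d+1)) (Fin (d+1)) ℝ).transpose.mulVec p.1 := by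
      fun_prop
    exact this.measurable (measurableSet_cone d s)
  have h1 : (γ.prod ν) T = c := by
    rw [Measure.prod_apply hT]
    have hae : ∀ᵐ w ∂γ, ν (Prod.mk w ⁻¹' T) = c := by
      have : ∀ᵐ w ∂γ, w ≠ 0 := by
        rw [ae_iff]
        refine measure_mono_null (t := (Function.eval 0) ⁻¹' {0}) ?_ ?_
        · intro w hw
          have : w = 0 := by simpa using hw
          simp [this]
        · have : NullSingletonClass (ProbabilityTheory.gaussianReal 0 1) :=
            ProbabilityTheory.nullSingletonClass_gaussianReal one_ne_zero
          exact Measure.pi_eval_preimage_null _ (measure_singleton _)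
      filter_upwards [this] with w hw
      exact hconst w hw
    rw [lintegral_congr_ae hae]; simp
  have h2 : (γ.prod ν) T = γ (cone d s) := by
    rw [Measure.prod_apply_symm hT]
    have : ∀ h : OG (d+1), γ ((fun x => (x, h)) ⁻¹' T) = γ (cone d s) := by
      intro h
      exact gauss_invariant h⁻¹ (measurableSet_cone d s)
    simp [this]
  rw [← h1, h2]

/-- isometric embedding `ℝ^(d+1) → ℝ^(d+k)` whose range is spanned by the first `d` basis vectors
and the normalized diagonal of the last `k` coordinates -/
def embJ (d k : ℕ) : Matrix (Fin (d+k)) (Fin (d+1)) ℝ := Matrix.of fun i j =>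
  Fin.addCases (motive := fun _ => ℝ)
    (fun a : Fin d => Fin.cases (motive := fun _ => ℝ) 0 (fun b => if a = b then 1 else 0) j)
    (fun _ : Fin k => Fin.cases (motive := fun _ => ℝ) (√(k:ℝ))⁻¹ (fun _ => 0) j) i

lemma embJ_isom {d k : ℕ} (hk : 0 < k) : (embJ d k).transpose * embJ d k = 1 := by
  have hk' : (0:ℝ) < k := by exact_mod_cast hk
  ext i j
  rw [Matrix.mul_apply, Fin.sum_univ_add]
  refine Fin.cases ?_ (fun i => ?_) i <;> refine Fin.cases ?_ (fun j => ?_) j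
  · simp [embJ, ← mul_inv, hk'.ne']
  · simp [embJ, Matrix.one_apply, Fin.succ_ne_zero, (Fin.succ_ne_zero _).symm]
  · simp [embJ, Matrix.one_apply, Fin.succ_ne_zero]
  · simp [embJ, Matrix.one_apply, eq_comm]

lemma embJ_castAdd {d k : ℕ} (z : Fin (d+1) → ℝ) (a : Fin d) :
    (embJ d k).mulVec z (Fin.castAdd k a) = z a.succ := by
  simp [Matrix.mulVec, dotProduct, embJ, Fin.sum_univ_succ]

lemma embJ_natAdd {d k : ℕ} (z : Fin (d+1) → ℝ) (b : Fin k) :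
    (embJ d k).mulVec z (Fin.natAdd d b) = (√(k:ℝ))⁻¹ * z 0 := by
  simp [Matrix.mulVec, dotProduct, embJ, Fin.sum_univ_succ]

def embM (d k : ℕ) (M : Matrix (Fin (d+1)) (Fin (d+1)) ℝ) : Matrix (Fin (d+k)) (Fin (d+k)) ℝ :=
  embJ d k * M * (embJ d k).transpose + (1 - embJ d k * (embJ d k).transpose)

lemma embM_mul_embJ {d k : ℕ} (hk : 0 < k) (M : Matrix (Fin (d+1)) (Fin (d+1)) ℝ) :
    embM d k M * embJ d k = embJ d k * M := by
  rw [embM, Matrix.add_mul, Matrix.sub_mul, Matrix.mul_assoc _ _ (embJ d k), Matrix.mul_assoc _ _ (embJ d k),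
    embJ_isom hk]
  simp

lemma embM_orth {d k : ℕ} (hk : 0 < k) (M : Matrix (Fin (d+1)) (Fin (d+1)) ℝ)
    (hM : M * M.transpose = 1) : embM d k M * (embM d k M).transpose = 1 := by
  have e : (embM d k M).transpose = embJ d k * (M.transpose * (embJ d k).transpose) +
      (1 - embJ d k * (embJ d k).transpose) := by
    simp [embM, Matrix.transpose_mul, Matrix.mul_assoc]
  rw [e, mul_add, ← Matrix.mul_assoc, embM_mul_embJ hk, mul_sub, ← Matrix.mul_assoc (embM d k M),
    embM_mul_embJ hk, mul_one, Matrix.mul_assoc (embJ d k) M, ← Matrix.mul_assoc M, hM, Matrix.one_mul,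
    embM]
  abel

def embG {d k : ℕ} (hk : 0 < k) (h : OG (d+1)) : OG (d+k) :=
  ⟨embM d k (h : Matrix (Fin (d+1)) (Fin (d+1)) ℝ).transpose,
    (Matrix.mem_orthogonalGroup_iff (Fin (d+k)) ℝ).2 (embM_orth hk _ (by
      rw [Matrix.transpose_transpose]; exact og_tr_mul h))⟩

lemma continuous_embG {d k : ℕ} (hk : 0 < k) : Continuous (embG (d := d) hk) := by
  refine Continuous.subtype_mk ?_ _
  unfold embM
  fun_prop

lemma exists_ker {d k : ℕ} (g : OG (d+k)) : ∃ z : Fin (d+1) → ℝ, z ≠ 0 ∧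
    ∀ i : Fin (d+k), k ≤ (i:ℕ) →
      ((g : Matrix (Fin (d+k)) (Fin (d+k)) ℝ).transpose * embJ d k).mulVec z i = 0 := by
  let A : Matrix (Fin d) (Fin (d+1)) ℝ := Matrix.of fun a j =>
    ((g : Matrix (Fin (d+k)) (Fin (d+k)) ℝ).transpose * embJ d k) ⟨k + a, by omega⟩ j
  have hker : (Matrix.toLin' A).ker ≠ ⊥ := LinearMap.ker_ne_bot_of_finrank_lt (by simp)
  obtain ⟨z, hz, hz0⟩ := (Submodule.ne_bot_iff _).1 hker
  refine ⟨z, hz0, fun i hi => ?_⟩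
  have h := congrFun (LinearMap.mem_ker.1 hz) ⟨i - k, by omega⟩
  rw [Matrix.toLin'_apply] at h
  have hi' : (⟨k + (i - k), by omega⟩ : Fin (d+k)) = i := Fin.ext (by simp; omega)
  rw [← hi']
  exact h

lemma geom {d k : ℕ} (hk : 0 < k) (g : OG (d+k)) (h : OG (d+1)) (z : Fin (d+1) → ℝ)
    (hz : ∀ i : Fin (d+k), k ≤ (i:ℕ) →
      ((g : Matrix (Fin (d+k)) (Fin (d+k)) ℝ).transpose * embJ d k).mulVec z i = 0)
    (hc : (h : Matrix (Fin (d+1)) (Fin (d+1)) ℝ).transpose.mulVec z ∈ cone d √(k:ℝ)) :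
    (act (embG hk h * g) '' Ek (d+k) k ∩ cubeFace (d+k) d).Nonempty := by
  have hk' : (0:ℝ) < √(k:ℝ) := Real.sqrt_pos.2 (by exact_mod_cast hk)
  set s := √(k:ℝ) with hs
  set w := (h : Matrix (Fin (d+1)) (Fin (d+1)) ℝ).transpose.mulVec z with hw
  obtain ⟨hw0, hwj⟩ := hc
  let x : Fin (d+k) → ℝ := (s / w 0) •
    ((g : Matrix (Fin (d+k)) (Fin (d+k)) ℝ).transpose * embJ d k).mulVec z
  have hx : ((embG hk h * g : OG (d+k)) : Matrix (Fin (d+k)) (Fin (d+k)) ℝ).mulVec x =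
      (s / w 0) • (embJ d k).mulVec w := by
    have e : ((embG hk h * g : OG (d+k)) : Matrix (Fin (d+k)) (Fin (d+k)) ℝ) =
      embM d k (h : Matrix (Fin (d+1)) (Fin (d+1)) ℝ).transpose *
        (g : Matrix (Fin (d+k)) (Fin (d+k)) ℝ) := rfl
    simp only [x]
    rw [Matrix.mulVec_smul, Matrix.mulVec_mulVec, e, Matrix.mul_assoc, ← Matrix.mul_assoc _ _ (embJ d k),
      og_mul_tr, Matrix.one_mul, embM_mul_embJ hk, hw, Matrix.mulVec_mulVec]
  refine ⟨WithLp.toLp 2 ((s / w 0) • (embJ d k).mulVec w), ⟨WithLp.toLp 2 x, ?_, ?_⟩, ?_, ?_⟩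
  · intro i hi
    simp [x, hz i hi]
  · rw [← hx]; rfl
  · intro i
    refine Fin.addCases (fun a _ => ?_) (fun b hb => ?_) i
    · simp only [Pi.smul_apply, embJ_castAdd, smul_eq_mul, abs_mul, abs_div]
      rw [div_mul_eq_mul_div, div_le_one (abs_pos.2 hw0), abs_of_pos hk']
      exact hwj a
    · simp at hb
  · intro i
    refine Fin.addCases (fun a ha => ?_) (fun b _ => ?_) i
    · have := a.2; simp at ha; omega
    · simp only [Pi.smul_apply, embJ_natAdd, smul_eq_mul, ← hs]
      field_simp

lemma prob_bound {d k : ℕ} (hd : 1 ≤ d) (hk : 0 < k) (H : Measure (OG (d+k)))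
    [H.IsHaarMeasure] [IsProbabilityMeasure H] :
    ENNReal.ofReal (2 / π * arctan (1/√(k:ℝ))) ^ d ≤
      H {g | (act g '' Ek (d+k) k ∩ cubeFace (d+k) d).Nonempty} := by
  have hk' : (0:ℝ) < √(k:ℝ) := Real.sqrt_pos.2 (by exact_mod_cast hk)
  set B : Set (OG (d+k)) := {g | (act g '' Ek (d+k) k ∩ cubeFace (d+k) d).Nonempty} with hB
  let K0 : TopologicalSpace.PositiveCompacts (OG (d+1)) := ⊤
  let ν : Measure (OG (d+1)) := Measure.haarMeasure K0
  have hν : IsProbabilityMeasure ν := ⟨Measure.haarMeasure_self (K₀ := K0)⟩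
  have hνi : ν.IsMulLeftInvariant := inferInstance
  set B' := toMeasurable H B with hB'
  have hB'm : MeasurableSet B' := measurableSet_toMeasurable H B
  have hBB : B ⊆ B' := subset_toMeasurable H B
  rw [← measure_toMeasurable B, ← hB']
  let T : Set (OG (d+k) × OG (d+1)) := {p | embG hk p.2 * p.1 ∈ B'}
  have hT : MeasurableSet T := by
    have : Continuous fun p : OG (d+k) × OG (d+1) => embG hk p.2 * p.1 :=
      ((continuous_embG hk).comp continuous_snd).mul continuous_fst
    exact this.measurable hB'm
  have h1 : (H.prod ν) T = H B' := by
    rw [Measure.prod_apply_symm hT]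
    have : ∀ h : OG (d+1), H ((fun x => (x, h)) ⁻¹' T) = H B' := fun h =>
      measure_preimage_mul H (embG hk h) B'
    simp [this]
  rw [← h1, Measure.prod_apply hT]
  have h2 : ∀ g : OG (d+k), ENNReal.ofReal (2 / π * arctan (1/√(k:ℝ))) ^ d ≤ ν (Prod.mk g ⁻¹' T) := by
    intro g
    obtain ⟨z, hz0, hz⟩ := exists_ker g
    refine (aux_cone hd hk').trans ?_
    rw [← orbit_measure (√(k:ℝ)) ν z hz0]
    exact measure_mono fun h hh => hBB (geom hk g h z hz hh)
  calc _ = ∫⁻ _ : OG (d+k), ENNReal.ofReal (2 / π * arctan (1/√(k:ℝ))) ^ d ∂H := by simp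
    _ ≤ _ := lintegral_mono h2

/-- `f(0,n-d,n) ≥ C(n,d) · 2ⁿ · ((1/π) arctan(1/√(n-d)))^d` for `1 ≤ d < n`. -/
theorem expected_vertices_codim_lower_bound (n d : ℕ) (hd : 1 ≤ d) (hdn : d < n)
    (H : Measure (OG n)) [H.IsHaarMeasure] [IsProbabilityMeasure H] :
    expFaces n H 0 (n - d) ≥
      (n.choose d) * 2 ^ n * ((1 / π) * Real.arctan (1 / Real.sqrt (n - d))) ^ d := by
  obtain ⟨k, rfl⟩ := Nat.exists_eq_add_of_le hdn.le
  have hk : 0 < k := by omega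
  have hb := prob_bound hd hk H
  have ha : 0 ≤ arctan (1/√(k:ℝ)) := arctan_nonneg.2 (by positivity)
  rw [← ENNReal.ofReal_pow (by positivity), ENNReal.ofReal_le_iff_le_toReal (measure_ne_top _ _)] at hb
  have e1 : d + k - d = k := by omega
  have e2 : d + k - k + 0 = d := by omega
  rw [expFaces, e1, e2, Nat.sub_zero, Nat.choose_symm_add, ge_iff_le]
  have e3 : ((d + k : ℕ) : ℝ) - d = k := by push_cast; ring
  rw [e3]
  calc _ = 2 ^ k * ((d+k).choose k : ℝ) * (2 / π * arctan (1/√(k:ℝ))) ^ d := by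
        rw [show 2 / π * arctan (1/√(k:ℝ)) = 2 * (1 / π * arctan (1/√(k:ℝ))) by ring,
          mul_pow 2, pow_add]
        ring
    _ ≤ _ := by
        exact mul_le_mul_of_nonneg_left hb (by positivity)
end
end

section
/- As n → ∞, f(0,n−1,n) ∼ 2^n √n / π; that is, the ratio f(0,n−1,n) / (2^n √n / π) tends to 1. -/
open MeasureTheory Filter Real

noncomputable section

lemma arc_aux (c : ℝ) (hc : 0 < c) (x : ℝ) (hx : -(π/2) < x) (hx' : x < π/2) :
    c * |sin x| ≤ |cos x| ↔ x ∈ Set.Icc (-arctan (1/c)) (arctan (1/c)) := by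
  have h := cos_pos_of_mem_Ioo ⟨hx, hx'⟩
  rw [Set.mem_Icc, ← arctan_neg, ← arctan_tan hx hx', arctan_le_arctan_iff,
    arctan_le_arctan_iff, ← abs_le, arctan_tan hx hx', tan_eq_sin_div_cos, abs_div,
    div_le_div_iff₀ (abs_pos.2 h.ne') hc]
  rw [mul_comm, one_mul]

/-- The `π`-periodic set of good angles. -/
def angSet (c : ℝ) : Set ℝ := {x | c * |sin x| ≤ |cos x|}

lemma angSet_closed (c : ℝ) : IsClosed (angSet c) :=
  isClosed_le (by fun_prop) (by fun_prop)

lemma angSet_int (c : ℝ) (k : ℤ) (x : ℝ) : k * π + x ∈ angSet c ↔ x ∈ angSet c := by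
  have e : (k * π + x) = x + k * π := by ring
  simp only [angSet, Set.mem_ofPred_eq, e]
  rw [sin_add_int_mul_pi, cos_add_int_mul_pi, abs_mul, abs_mul]
  simp

lemma angSet_base (c : ℝ) (hc : 0 < c) :
    volume (angSet c ∩ Set.Ioc (-(π/2)) (-(π/2) + π)) = ENNReal.ofReal (2 * arctan (1/c)) := by
  have : angSet c ∩ Set.Ioc (-(π/2)) (-(π/2) + π) = Set.Icc (-arctan (1/c)) (arctan (1/c)) := by
    ext x
    constructor
    · rintro ⟨h1, h2, h3⟩
      have h4 : x ≤ π/2 := by linarith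
      rcases h4.lt_or_eq with h | h
      · exact (arc_aux c hc x h2 h).1 h1
      · subst h
        simp only [angSet, Set.mem_ofPred_eq, sin_pi_div_two, cos_pi_div_two] at h1
        simp at h1
        linarith
    · intro h
      have h1 := neg_pi_div_two_lt_arctan (1/c)
      have h2 := arctan_lt_pi_div_two (1/c)
      have h3 : -(π/2) < x := by linarith [h.1]
      have h4 : x < π/2 := by linarith [h.2]
      exact ⟨(arc_aux c hc x h3 h4).2 h, h3, by linarith⟩
  rw [this, Real.volume_Icc]
  congr 1
  ring

lemma angSet_shift (c : ℝ) (hc : 0 < c) (φ : ℝ) :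
    volume ({x | x + φ ∈ angSet c} ∩ Set.Ioc (-(π/2)) (-(π/2) + π))
      = ENNReal.ofReal (2 * arctan (1/c)) := by
  rw [← angSet_base c hc]
  have h1 := (isAddFundamentalDomain_Ioc pi_pos (-(π/2)) volume).measure_set_eq
    (isAddFundamentalDomain_Ioc pi_pos (-(π/2) + φ) volume) (A := angSet c)
    (angSet_closed c).measurableSet (by
      rintro ⟨g, k, rfl⟩
      ext x
      have := angSet_int c k x
      simpa [AddSubgroup.vadd_def] using this)
  rw [h1, ← (measurePreserving_add_right volume φ).measure_preimage
    ((angSet_closed c).measurableSet.inter measurableSet_Ioc).nullMeasurableSet]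
  congr 1
  ext x
  simp only [Set.mem_inter_iff, Set.mem_ofPred_eq, Set.mem_Ioc, Set.mem_preimage]
  refine and_congr Iff.rfl (and_congr ?_ ?_)
  · constructor <;> intro h <;> linarith
  · constructor <;> intro h <;> linarith

/-- The double cone. -/
def dcone (c : ℝ) : Set (ℝ × ℝ) := {p | c * |p.2| ≤ |p.1|}

lemma dcone_closed (c : ℝ) : IsClosed (dcone c) :=
  isClosed_le (f := fun p : ℝ × ℝ => c * |p.2|) (g := fun p : ℝ × ℝ => |p.1|)
    (by fun_prop) (by fun_prop)

lemma slice_meas (c : ℝ) (hc : 0 < c) (p : ℝ × ℝ) (hp : p ≠ 0) :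
    volume ({x : ℝ | (cos x * p.1 - sin x * p.2, sin x * p.1 + cos x * p.2) ∈ dcone c}
      ∩ Set.Ioc (-(π/2)) (-(π/2) + π))
      = ENNReal.ofReal (2 * arctan (1/c)) := by
  set z : ℂ := ⟨p.1, p.2⟩ with hz
  have hz0 : 0 < ‖z‖ := by
    rw [norm_pos_iff]
    intro h
    apply hp
    have h1 := congrArg Complex.re h
    have h2 := congrArg Complex.im h
    exact Prod.ext h1 h2
  have e1 : p.1 = ‖z‖ * cos z.arg := (Complex.norm_mul_cos_arg z).symm
  have e2 : p.2 = ‖z‖ * sin z.arg := (Complex.norm_mul_sin_arg z).symm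
  rw [← angSet_shift c hc z.arg]
  congr 2
  ext x
  simp only [dcone, angSet, Set.mem_ofPred_eq]
  rw [sin_add, cos_add, e1, e2]
  have a1 : sin x * (‖z‖ * cos z.arg) + cos x * (‖z‖ * sin z.arg)
    = ‖z‖ * (sin x * cos z.arg + cos x * sin z.arg) := by ring
  have a2 : cos x * (‖z‖ * cos z.arg) - sin x * (‖z‖ * sin z.arg)
    = ‖z‖ * (cos x * cos z.arg - sin x * sin z.arg) := by ring
  rw [a1, a2, abs_mul, abs_mul, abs_norm, mul_left_comm, mul_le_mul_iff_right₀ hz0]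

lemma cone_measure (c : ℝ) (hc : 0 < c) (μ : Measure (ℝ × ℝ)) [IsProbabilityMeasure μ]
    (h0 : μ {0} = 0)
    (hrot : ∀ x : ℝ, μ {p | (cos x * p.1 - sin x * p.2, sin x * p.1 + cos x * p.2) ∈ dcone c}
      = μ (dcone c)) :
    (μ (dcone c)).toReal = 2 * arctan (1/c) / π := by
  set I := Set.Ioc (-(π/2)) (-(π/2) + π)
  set D : Set (ℝ × (ℝ × ℝ)) := {q | (cos q.1 * q.2.1 - sin q.1 * q.2.2,
    sin q.1 * q.2.1 + cos q.1 * q.2.2) ∈ dcone c} with hD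
  have hDm : MeasurableSet D := by
    exact ((dcone_closed c).preimage (f := fun q : ℝ × (ℝ × ℝ) =>
      (cos q.1 * q.2.1 - sin q.1 * q.2.2, sin q.1 * q.2.1 + cos q.1 * q.2.2))
      (by fun_prop)).measurableSet
  have h1 := Measure.prod_apply (μ := volume.restrict I) (ν := μ) hDm
  have h2 := Measure.prod_apply_symm (μ := volume.restrict I) (ν := μ) hDm
  rw [h1] at h2
  have h3 : ∀ x : ℝ, μ (Prod.mk x ⁻¹' D) = μ (dcone c) := fun x => hrot x
  simp only [h3, lintegral_const] at h2
  have h4 : ∀ᵐ p ∂μ, (volume.restrict I) ((fun x => (x, p)) ⁻¹' D)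
      = ENNReal.ofReal (2 * arctan (1/c)) := by
    have : ∀ᵐ p ∂μ, p ≠ 0 := by
      rw [ae_iff]; simpa using h0
    filter_upwards [this] with p hp
    rw [Measure.restrict_apply' measurableSet_Ioc]
    exact slice_meas c hc p hp
  rw [lintegral_congr_ae h4, lintegral_const, measure_univ (μ := μ), mul_one,
    Measure.restrict_apply_univ, Real.volume_Ioc] at h2
  have h5 := congrArg ENNReal.toReal h2
  have h6 : 0 ≤ arctan (1/c) := arctan_nonneg.2 (by positivity)
  rw [ENNReal.toReal_mul, ENNReal.toReal_ofReal (by linarith [pi_pos]),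
    ENNReal.toReal_ofReal (by linarith)] at h5
  rw [eq_div_iff pi_ne_zero, ← h5]
  ring

/-- Last column. -/
def lcol {m : ℕ} (g : OG (m+2)) : EuclideanSpace ℝ (Fin (m+2)) :=
  WithLp.toLp 2 (fun i => (g : Matrix (Fin (m+2)) (Fin (m+2)) ℝ) i (Fin.last (m+1)))

lemma lcol_cont {m : ℕ} : Continuous (lcol (m := m)) := by
  unfold lcol
  refine (PiLp.continuous_toLp 2 _).comp ?_
  refine continuous_pi fun i => ?_
  exact (continuous_apply_apply i (Fin.last (m+1))).comp continuous_subtype_val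

lemma lcol_ne {m : ℕ} (g : OG (m+2)) : lcol g ≠ 0 := by
  intro h
  have h1 := (Matrix.mem_orthogonalGroup_iff' _ _).1 g.2
  have h2 := congrFun (congrFun h1 (Fin.last (m+1))) (Fin.last (m+1))
  have h3 : ∀ i, (g : Matrix (Fin (m+2)) (Fin (m+2)) ℝ) i (Fin.last (m+1)) = 0 := fun i => by
    have := congrArg (fun v : EuclideanSpace ℝ (Fin (m+2)) => v i) h
    simpa [lcol] using this
  simp [Matrix.mul_apply, h3] at h2

/-- The law of the inner products with an orthonormal basis does not depend on the basis. -/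
lemma basis_inv {m : ℕ} (H : Measure (OG (m+2))) [H.IsHaarMeasure]
    (b : OrthonormalBasis (Fin (m+2)) ℝ (EuclideanSpace ℝ (Fin (m+2))))
    (T : Set (EuclideanSpace ℝ (Fin (m+2)))) :
    H {g | WithLp.toLp 2 (fun i => inner ℝ (b i) (lcol g)) ∈ T} = H {g | lcol g ∈ T} := by
  let B : Matrix (Fin (m+2)) (Fin (m+2)) ℝ := fun i j => b i j
  have hB : B ∈ Matrix.orthogonalGroup (Fin (m+2)) ℝ := by
    rw [Matrix.mem_orthogonalGroup_iff]
    ext i j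
    have h := orthonormal_iff_ite.1 b.orthonormal j i
    rw [Matrix.mul_apply, Matrix.one_apply]
    simp only [PiLp.inner_apply, RCLike.inner_apply, conj_trivial] at h
    refine Eq.trans h ?_
    simp [eq_comm]
  rw [← measure_preimage_mul H (⟨B, hB⟩ : OG (m+2)) {g | lcol g ∈ T}]
  congr 1
  ext g
  simp only [Set.mem_ofPred_eq, Set.mem_preimage]
  have : WithLp.toLp 2 (fun i => inner ℝ (b i) (lcol g)) = lcol ((⟨B, hB⟩ : OG (m+2)) * g) := by
    ext i
    have : lcol ((⟨B, hB⟩ : OG (m+2)) * g) i = ∑ j, B i j * lcol g j := by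
      simp only [lcol]
      exact Matrix.mul_apply
    rw [this]
    simp [PiLp.inner_apply, B, mul_comm]
  rw [this]

lemma unit_null {m : ℕ} (H : Measure (OG (m+2))) [H.IsHaarMeasure] [IsProbabilityMeasure H]
    (w : EuclideanSpace ℝ (Fin (m+2))) (hw : ‖w‖ = 1) :
    H {g | inner ℝ w (lcol g) = 0} = H {g | lcol g 0 = 0} := by
  obtain ⟨b, hb⟩ := Orthonormal.exists_orthonormalBasis_extension_of_card_eq (𝕜 := ℝ)
    (E := EuclideanSpace ℝ (Fin (m+2))) (ι := Fin (m+2)) (by simp) (v := fun _ => w) (s := {0}) (by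
      rw [orthonormal_iff_ite]
      rintro ⟨i, hi⟩ ⟨j, hj⟩
      simp only [Set.mem_singleton_iff] at hi hj
      subst hi; subst hj
      simp [Set.domRestrict, hw])
  have h := basis_inv H b {v | v 0 = 0}
  have h0 : b 0 = w := hb 0 (by simp)
  simpa [h0] using h

lemma coord_null {m : ℕ} (H : Measure (OG (m+2))) [H.IsHaarMeasure] [IsProbabilityMeasure H] :
    H {g | lcol g 0 = 0} = 0 := by
  set ν := H.map (lcol (m := m))
  have hm : Measurable (lcol (m := m)) := lcol_cont.measurable
  have : IsProbabilityMeasure ν := Measure.isProbabilityMeasure_map hm.aemeasurable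
  let D : Set (EuclideanSpace ℝ (Fin (m+2)) × EuclideanSpace ℝ (Fin (m+2))) := {q | inner ℝ q.1 q.2 = 0}
  have hD : MeasurableSet D := (isClosed_eq (by fun_prop) (by fun_prop)).measurableSet
  have hz : ((volume : Measure (EuclideanSpace ℝ (Fin (m+2)))).prod ν) D = 0 := by
    rw [Measure.prod_apply_symm hD]
    rw [lintegral_map (measurable_measure_prodMk_right hD) hm]
    refine (lintegral_congr fun g => ?_).trans lintegral_zero
    have e : ((fun x => (x, lcol g)) ⁻¹' D) = (((ℝ ∙ lcol g)ᗮ : Submodule ℝ (EuclideanSpace ℝ (Fin (m+2)))) : Set (EuclideanSpace ℝ (Fin (m+2)))) := by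
      ext x
      simp only [Set.mem_preimage, D, Set.mem_ofPred_eq, SetLike.mem_coe,
        Submodule.mem_orthogonal_singleton_iff_inner_left]
    show volume ((fun x => (x, lcol g)) ⁻¹' D) = 0
    rw [e]
    apply Measure.addHaar_submodule
    intro ht
    have : lcol g ∈ (ℝ ∙ lcol g)ᗮ := by rw [ht]; trivial
    rw [Submodule.mem_orthogonal_singleton_iff_inner_left, inner_self_eq_zero] at this
    exact lcol_ne g this
  have h1 := Measure.measure_ae_null_of_prod_null hz
  have h2 : ∀ᵐ x : EuclideanSpace ℝ (Fin (m+2)), x ≠ 0 := by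
    rw [ae_iff]; simp
  obtain ⟨w, hw, hw0⟩ := (h1.and h2).exists
  have hs : MeasurableSet (Prod.mk w ⁻¹' D) := measurable_prodMk_left hD
  change (H.map (lcol (m := m))) (Prod.mk w ⁻¹' D) = 0 at hw
  rw [Measure.map_apply hm hs] at hw
  rw [← unit_null H (‖w‖⁻¹ • w) (by simp [norm_smul, hw0]), ← hw]
  congr 1
  ext g
  simp [D, inner_smul_left, hw0]

lemma pair_law {m : ℕ} (H : Measure (OG (m+2))) [H.IsHaarMeasure] [IsProbabilityMeasure H]
    (v w : EuclideanSpace ℝ (Fin (m+2))) (hv : inner ℝ v v = (1:ℝ)) (hw : inner ℝ w w = (1:ℝ))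
    (hvw : inner ℝ v w = (0:ℝ)) (T : Set (ℝ × ℝ)) :
    H {g | (inner ℝ v (lcol g), inner ℝ w (lcol g)) ∈ T} = H {g | (lcol g 0, lcol g 1) ∈ T} := by
  have hwv : inner ℝ w v = (0:ℝ) := by rw [real_inner_comm, hvw]
  obtain ⟨b, hb⟩ := Orthonormal.exists_orthonormalBasis_extension_of_card_eq (𝕜 := ℝ)
    (E := EuclideanSpace ℝ (Fin (m+2))) (ι := Fin (m+2)) (by simp)
    (v := fun i => if i = 0 then v else w) (s := {0, 1}) (by
      rw [orthonormal_iff_ite]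
      rintro ⟨i, hi⟩ ⟨j, hj⟩
      simp only [Set.mem_singleton_iff, Set.mem_insert_iff] at hi hj
      rcases hi with rfl | rfl <;> rcases hj with rfl | rfl <;>
      simp only [Set.domRestrict] <;> simp [hv, hw, hvw, hwv, - inner_self_eq_norm_sq_to_K])
  have h := basis_inv H b {v | (v 0, v 1) ∈ T}
  have h0 : b 0 = v := by rw [hb 0 (by simp)]; simp
  have h1 : b 1 = w := by rw [hb 1 (by simp)]; simp
  simpa [h0, h1] using h

lemma pair_cone {m : ℕ} (H : Measure (OG (m+2))) [H.IsHaarMeasure] [IsProbabilityMeasure H]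
    (v w : EuclideanSpace ℝ (Fin (m+2))) (hv : inner ℝ v v = (1:ℝ)) (hw : inner ℝ w w = (1:ℝ))
    (hvw : inner ℝ v w = (0:ℝ)) (c : ℝ) (hc : 0 < c) :
    (H {g | (inner ℝ v (lcol g), inner ℝ w (lcol g)) ∈ dcone c}).toReal
      = 2 * arctan (1/c) / π := by
  have hwv : inner ℝ w v = (0:ℝ) := by rw [real_inner_comm, hvw]
  let F : OG (m+2) → ℝ × ℝ := fun g => (inner ℝ v (lcol g), inner ℝ w (lcol g))
  have hF : Measurable F := by
    have := lcol_cont (m := m)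
    exact Continuous.measurable (by fun_prop)
  have : IsProbabilityMeasure (H.map F) := Measure.isProbabilityMeasure_map hF.aemeasurable
  have hT : MeasurableSet (dcone c) := (dcone_closed c).measurableSet
  have key := cone_measure c hc (H.map F) ?_ ?_
  · rwa [Measure.map_apply hF hT] at key
  · rw [Measure.map_apply hF (measurableSet_singleton _)]
    have h1 := pair_law H v w hv hw hvw {0}
    change H {g | F g ∈ ({0} : Set (ℝ × ℝ))} = 0
    rw [h1]
    refine measure_mono_null ?_ (coord_null H)
    intro g hg
    exact congrArg Prod.fst (Set.mem_singleton_iff.1 hg)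
  · intro x
    have hT' : MeasurableSet {p : ℝ × ℝ |
        (cos x * p.1 - sin x * p.2, sin x * p.1 + cos x * p.2) ∈ dcone c} :=
      ((dcone_closed c).preimage (f := fun p : ℝ × ℝ =>
        (cos x * p.1 - sin x * p.2, sin x * p.1 + cos x * p.2)) (by fun_prop)).measurableSet
    rw [Measure.map_apply hF hT, Measure.map_apply hF hT']
    have h1 := pair_law H v w hv hw hvw (dcone c)
    have h2 := pair_law H (cos x • v - sin x • w) (sin x • v + cos x • w)
      (by simp only [inner_sub_left, inner_sub_right, real_inner_smul_left, real_inner_smul_right,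
            hv, hw, hvw, hwv]
          nlinarith [sin_sq_add_cos_sq x])
      (by simp only [inner_add_left, inner_add_right, real_inner_smul_left, real_inner_smul_right,
            hv, hw, hvw, hwv]
          nlinarith [sin_sq_add_cos_sq x])
      (by simp only [inner_sub_left, inner_add_right, real_inner_smul_left, real_inner_smul_right,
            hv, hw, hvw, hwv]
          ring) (dcone c)
    rw [← h1] at h2
    simp only [inner_sub_left, inner_add_left, real_inner_smul_left] at h2
    exact h2

lemma mem_image_iff {m : ℕ} (g : OG (m+2)) (y : EuclideanSpace ℝ (Fin (m+2))) :
    y ∈ act g '' Ek (m+2) (m+1) ↔ ∑ i, lcol g i * y i = 0 := by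
  have h1 := (Matrix.mem_orthogonalGroup_iff' _ _).1 g.2
  have h2 := (Matrix.mem_orthogonalGroup_iff _ _).1 g.2
  have key : ∀ z : EuclideanSpace ℝ (Fin (m+2)), z ∈ Ek (m+2) (m+1) ↔ z (Fin.last (m+1)) = 0 := by
    intro z
    constructor
    · intro h; exact h _ (by simp)
    · intro h i hi
      have : i = Fin.last (m+1) := by
        apply Fin.ext; have := i.2; simp; omega
      rw [this, h]
  have e : ∀ y : EuclideanSpace ℝ (Fin (m+2)), (Matrix.toEuclideanLin
      ((g : Matrix (Fin (m+2)) (Fin (m+2)) ℝ).transpose) y) (Fin.last (m+1))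
      = ∑ i, lcol g i * y i := by
    intro y
    simp [Matrix.toLpLin_apply, Matrix.mulVec, dotProduct, lcol]
  constructor
  · rintro ⟨x, hx, rfl⟩
    rw [← e, act]
    rw [key] at hx
    simp only [Matrix.toLpLin_apply, Matrix.mulVec_mulVec]
    simp [h1, hx]
  · intro h
    refine ⟨Matrix.toEuclideanLin ((g : Matrix (Fin (m+2)) (Fin (m+2)) ℝ).transpose) y, ?_, ?_⟩
    · rw [key, e, h]
    · simp only [act, Matrix.toLpLin_apply, Matrix.mulVec_mulVec]
      simp [h2]

lemma event_iff {m : ℕ} (g : OG (m+2)) :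
    (act g '' Ek (m+2) (m+1) ∩ cubeFace (m+2) 1).Nonempty ↔
      |∑ i : Fin (m+1), lcol g i.succ| ≤ |lcol g 0| := by
  set s := ∑ i : Fin (m+1), lcol g i.succ with hs
  constructor
  · rintro ⟨y, hy, hy1, hy2⟩
    rw [mem_image_iff, Fin.sum_univ_succ] at hy
    have : ∀ i : Fin (m+1), y i.succ = 1 := fun i => hy2 _ (by simp)
    simp only [this, mul_one, ← hs] at hy
    have h0 : |y 0| ≤ 1 := hy1 0 (by simp)
    have : s = -(lcol g 0 * y 0) := by linarith
    rw [this, abs_neg, abs_mul]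
    exact mul_le_of_le_one_right (abs_nonneg _) h0
  · intro h
    refine ⟨WithLp.toLp 2 (Fin.cons (-(s / lcol g 0)) (fun _ => 1)), ?_, ?_, ?_⟩
    · rw [mem_image_iff, Fin.sum_univ_succ]
      simp only [Fin.cons_zero, Fin.cons_succ, mul_one, ← hs]
      by_cases h0 : lcol g 0 = 0
      · have : s = 0 := by simpa [h0] using h
        simp [h0, this]
      · field_simp
        ring
    · intro i hi
      have : i = 0 := Fin.ext (by simpa using hi)
      subst this
      simp only [Fin.cons_zero, abs_neg, abs_div]
      exact div_le_one_of_le₀ h (abs_nonneg _)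
    · intro i hi
      obtain ⟨j, rfl⟩ := Fin.exists_succ_eq.2 (show i ≠ 0 by rintro rfl; simp at hi)
      simp

lemma prob_eq {m : ℕ} (H : Measure (OG (m+2))) [H.IsHaarMeasure] [IsProbabilityMeasure H] :
    (H {g | (act g '' Ek (m+2) (m+1) ∩ cubeFace (m+2) 1).Nonempty}).toReal
      = 2 * arctan (1 / √(m+1)) / π := by
  have hc : 0 < √((m:ℝ)+1) := by positivity
  have hc2 : √((m:ℝ)+1) * √((m:ℝ)+1) = m + 1 := mul_self_sqrt (by positivity)
  let v : EuclideanSpace ℝ (Fin (m+2)) := WithLp.toLp 2 (Fin.cons 1 (fun _ => 0))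
  let w : EuclideanSpace ℝ (Fin (m+2)) := WithLp.toLp 2 (Fin.cons 0 (fun _ => 1 / √((m:ℝ)+1)))
  rw [← pair_cone H v w ?_ ?_ ?_ _ hc]
  · congr 2
    ext g
    rw [Set.mem_ofPred_eq, event_iff]
    have e1 : inner ℝ v (lcol g) = lcol g 0 := by
      simp [v, PiLp.inner_apply, Fin.sum_univ_succ]
    have e2 : √((m:ℝ)+1) * |inner ℝ w (lcol g)| = |∑ i : Fin (m+1), lcol g i.succ| := by
      nth_rewrite 1 [← abs_of_pos hc]
      rw [← abs_mul]
      congr 1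
      simp only [w, PiLp.inner_apply, Fin.sum_univ_succ (n := m+1), RCLike.inner_apply,
        conj_trivial, Fin.cons_zero, Fin.cons_succ, mul_zero, zero_add, ← Finset.sum_mul]
      field_simp
    simp only [dcone, Set.mem_ofPred_eq, e1, e2]
  · simp only [v, PiLp.inner_apply, Fin.sum_univ_succ (n := m+1)]
    simp
  · simp only [w, PiLp.inner_apply, Fin.sum_univ_succ (n := m+1), RCLike.inner_apply,
        conj_trivial, Fin.cons_zero, Fin.cons_succ, mul_zero, zero_add, Finset.sum_const,
        Finset.card_univ, Fintype.card_fin, nsmul_eq_mul]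
    push_cast
    field_simp
    rw [sq, hc2]
  · simp only [v, w, PiLp.inner_apply, Fin.sum_univ_succ (n := m+1)]
    simp

lemma asymp : Tendsto (fun m : ℕ => √((m:ℝ)+2) * arctan (1 / √((m:ℝ)+1))) atTop (nhds 1) := by
  have h1 : Tendsto (fun m : ℕ => 1 / √((m:ℝ)+1)) atTop (nhdsWithin 0 {0}ᶜ) := by
    rw [tendsto_nhdsWithin_iff]
    constructor
    · simp only [one_div]
      refine tendsto_inv_atTop_zero.comp (tendsto_sqrt_atTop.comp ?_)
      exact tendsto_atTop_add_const_right _ _ tendsto_natCast_atTop_atTop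
    · refine Eventually.of_forall fun m => ?_
      have : 0 < √((m:ℝ)+1) := by positivity
      simp [this.ne']
  have h2 := (hasDerivAt_iff_tendsto_slope.1 (hasDerivAt_arctan 0)).comp h1
  have h3 : Tendsto (fun m : ℕ => √(1 + 1 / ((m:ℝ)+1))) atTop (nhds (√(1 + 0))) :=
    (Real.continuous_sqrt.tendsto _).comp
      (tendsto_const_nhds.add tendsto_one_div_add_atTop_nhds_zero_nat)
  have h4 := h3.mul h2
  simp only [add_zero, sqrt_one, one_mul] at h4
  norm_num at h4
  refine h4.congr fun m => ?_
  have hc : 0 < √((m:ℝ)+1) := by positivity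
  have e : √((m:ℝ)+2) = √(1 + ((m:ℝ)+1)⁻¹) * √((m:ℝ)+1) := by
    rw [← sqrt_mul (by positivity)]
    congr 1
    field_simp
    ring
  simp only [Function.comp, slope_def_field, arctan_zero, sub_zero, e]
  simp only [one_div]
  field_simp

/-- `f(0,n-1,n) ∼ 2ⁿ √n / π` as `n → ∞`. -/
theorem expected_vertices_hyperplane_asymptotics
    (H : ∀ n, Measure (OG n))
    (hHaar : ∀ n, (H n).IsHaarMeasure) (hProb : ∀ n, IsProbabilityMeasure (H n)) :
    Tendsto (fun n : ℕ =>
        expFaces n (H n) 0 (n - 1) / (2 ^ n * Real.sqrt n / π))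
      atTop (nhds 1) := by
  rw [← tendsto_add_atTop_iff_nat 2]
  refine asymp.congr fun m => ?_
  have := hHaar (m+2)
  have := hProb (m+2)
  have e := prob_eq (H (m+2))
  have e1 : m + 2 - 1 = m + 1 := rfl
  have e2 : m + 2 - (m + 1) + 0 = 1 := by omega
  have e3 : (m+2).choose (m+1) = m+2 := Nat.choose_succ_self_right (m+1)
  simp only [expFaces, e1, e2, e, Nat.sub_zero, e3]
  have hs : √((m:ℝ)+2) * √((m:ℝ)+2) = m + 2 := mul_self_sqrt (by positivity)
  have hp : 0 < √((m:ℝ)+2) := by positivity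
  push_cast
  rw [eq_div_iff (by positivity)]
  have hpi := pi_ne_zero
  rw [pow_succ 2 (m+1)]
  field_simp
  linear_combination hs
end
end
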